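/- Let K be a field of arbitrary characteristic and let A be an affine line arrangement in K² with χ(A,t) = (t − n)(t − n − r), where n, r ∈ ℤ_{≥0} and r ≥ 4. Assume that A contains a free subarrangement B with exp₀(B) = (n − 3, n − 3). Then A is free if and only if n_H = n or n_H = n + r for some line H ∈ A. -/

import Mathlib

open MvPolynomial

variable {K : Type*} [Field K]

/-- A subset of `K × K` is an affine line: the zero set of a nonzero degree-one equation. -/
def IsAffineLine (L : Set (K × K)) : Prop :=
  ∃ a b c : K, (a, b) ≠ (0, 0) ∧ L = {p : K × K | a * p.1 + b * p.2 + c = 0}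

/-- An affine line arrangement: a finite set of affine lines in `K²`. -/
def IsLineArr (A : Finset (Set (K × K))) : Prop :=
  ∀ L ∈ A, IsAffineLine L

open Classical in
/-- The second Betti number `b₂(A)` of a line arrangement, via Whitney's theorem:
`b₂(A) = ∑ (-1)^{|B|}` over the subsets `B ⊆ A` with `|B| ≥ 2` and `⋂ B ≠ ∅`. -/
noncomputable def b2 (A : Finset (Set (K × K))) : ℤ :=
  ∑ B ∈ A.powerset.filter
      (fun B : Finset (Set (K × K)) => 2 ≤ B.card ∧ (⋂ L ∈ B, (L : Set (K × K))).Nonempty),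
    (-1 : ℤ) ^ B.card

/-- The characteristic polynomial `χ(A,t) = t² − |A|·t + b₂(A)`, evaluated at `t : ℂ`. -/
noncomputable def chi (A : Finset (Set (K × K))) (t : ℂ) : ℂ :=
  t ^ 2 - (A.card : ℂ) * t + (b2 A : ℂ)

/-- `nOn A H = |A ∩ H|`: the number of intersection points, lying on the line `H`, of `H`
with the lines of `A` other than `H`. -/
noncomputable def nOn (A : Finset (Set (K × K))) (H : Set (K × K)) : ℕ :=
  Set.ncard {p : K × K | p ∈ H ∧ ∃ L ∈ A, L ≠ H ∧ p ∈ L}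

/-- The linear form `a·x + b·y + c·z` in `K[x,y,z]`. -/
noncomputable def lin3 (a b c : K) : MvPolynomial (Fin 3) K :=
  C a * X 0 + C b * X 1 + C c * X 2

/-- The action on `f` of the derivation with coefficient vector `θ`. -/
noncomputable def applyDer3 (θ : Fin 3 → MvPolynomial (Fin 3) K)
    (f : MvPolynomial (Fin 3) K) : MvPolynomial (Fin 3) K :=
  ∑ i, θ i * pderiv i f

/-- `θ` belongs to `D(cA)`, the logarithmic derivation module of the cone of `A`:
`θ(α_H) ∈ S·α_H` for every `H ∈ cA`, where `cA` consists of the homogenizations of the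
lines of `A` together with the plane `z = 0`. -/
def InDCone (A : Finset (Set (K × K))) (θ : Fin 3 → MvPolynomial (Fin 3) K) : Prop :=
  (∀ L ∈ A, ∀ a b c : K, (a, b) ≠ (0, 0) →
      L = {p : K × K | a * p.1 + b * p.2 + c = 0} →
      ∃ g, applyDer3 θ (lin3 a b c) = g * lin3 a b c) ∧
  (∃ g, applyDer3 θ (X 2) = g * (X 2 : MvPolynomial (Fin 3) K))

/-- A homogeneous derivation of degree `d` on `K[x,y,z]`. -/
def HomogDer3 (θ : Fin 3 → MvPolynomial (Fin 3) K) (d : ℕ) : Prop :=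
  ∀ i, (θ i).IsHomogeneous d

/-- `A` is free with exponents `exp₀(A) = (d₁, d₂)`: `D(cA)` is a free module with a
homogeneous basis consisting of the Euler derivation `x∂ₓ + y∂_y + z∂_z` and two
derivations of degrees `d₁` and `d₂`. -/
def IsFreeExp (A : Finset (Set (K × K))) (d₁ d₂ : ℕ) : Prop :=
  ∃ θ₁ θ₂ : Fin 3 → MvPolynomial (Fin 3) K,
    InDCone A θ₁ ∧ InDCone A θ₂ ∧ HomogDer3 θ₁ d₁ ∧ HomogDer3 θ₂ d₂ ∧
    ∀ θ : Fin 3 → MvPolynomial (Fin 3) K, InDCone A θ →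
      ∃! cfs : MvPolynomial (Fin 3) K × MvPolynomial (Fin 3) K × MvPolynomial (Fin 3) K,
        θ = fun j => cfs.1 * X j + cfs.2.1 * θ₁ j + cfs.2.2 * θ₂ j

/-- `A` is free (with some exponents). -/
def IsFree (A : Finset (Set (K × K))) : Prop := ∃ d₁ d₂ : ℕ, IsFreeExp A d₁ d₂

/-- `A` is free with (integer-valued) exponents `exp₀(A) = (d₁, d₂)`. -/
def IsFreeExpZ (A : Finset (Set (K × K))) (d₁ d₂ : ℤ) : Prop :=
  ∃ e₁ e₂ : ℕ, (e₁ : ℤ) = d₁ ∧ (e₂ : ℤ) = d₂ ∧ IsFreeExp A e₁ e₂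

section Homogeneous

variable {σ : Type*}

lemma homogeneousComponent_homogeneous_mul {p : MvPolynomial σ K} {m : ℕ} (hp : p.IsHomogeneous m)
    (q : MvPolynomial σ K) (n : ℕ) :
    homogeneousComponent (m + n) (p * q) = p * homogeneousComponent n q := by
  classical
  conv_lhs => rw [← sum_homogeneousComponent q, Finset.mul_sum, map_sum]
  have h : ∀ i, homogeneousComponent (m + n) (p * homogeneousComponent i q)
      = if n = i then p * homogeneousComponent i q else 0 := by
    intro i
    rw [homogeneousComponent_of_mem (hp.mul (homogeneousComponent_isHomogeneous i q))]
    simp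
  simp only [h, Finset.sum_ite_eq, Finset.mem_range]
  split_ifs with hn
  · rfl
  · rw [homogeneousComponent_eq_zero _ _ (by omega), mul_zero]

lemma homogeneousComponent_homogeneous_mul_of_lt {p : MvPolynomial σ K} {m : ℕ}
    (hp : p.IsHomogeneous m) (q : MvPolynomial σ K) {d : ℕ} (hd : d < m) :
    homogeneousComponent d (p * q) = 0 := by
  classical
  rw [← sum_homogeneousComponent q, Finset.mul_sum, map_sum]
  refine Finset.sum_eq_zero fun i _ => ?_
  rw [homogeneousComponent_of_mem (hp.mul (homogeneousComponent_isHomogeneous i q)),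
    if_neg (by omega)]

lemma dvd_homogeneousComponent {p q : MvPolynomial σ K} {m : ℕ} (hp : p.IsHomogeneous m)
    (h : p ∣ q) (d : ℕ) : p ∣ homogeneousComponent d q := by
  obtain ⟨g, rfl⟩ := h
  by_cases hd : d < m
  · rw [homogeneousComponent_homogeneous_mul_of_lt hp g hd]
    exact dvd_zero _
  · obtain ⟨e, rfl⟩ := Nat.exists_eq_add_of_le (not_lt.mp hd)
    rw [homogeneousComponent_homogeneous_mul hp]
    exact dvd_mul_right _ _

lemma isHomogeneous_of_mul_left {p q : MvPolynomial σ K} {m n : ℕ} (hp : p.IsHomogeneous m)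
    (hp0 : p ≠ 0) (h : (p * q).IsHomogeneous (m + n)) : q.IsHomogeneous n := by
  have h1 := homogeneousComponent_homogeneous_mul hp q n
  rw [homogeneousComponent_eq_self h] at h1
  rw [mul_left_cancel₀ hp0 h1]
  exact homogeneousComponent_isHomogeneous n q

lemma eq_zero_of_dvd_of_lt {p q : MvPolynomial σ K} {m d : ℕ} (hp : p.IsHomogeneous m)
    (hq : q.IsHomogeneous d) (h : p ∣ q) (hd : d < m) : q = 0 := by
  obtain ⟨g, rfl⟩ := h
  rw [← homogeneousComponent_eq_self hq, homogeneousComponent_homogeneous_mul_of_lt hp g hd]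

lemma homogeneousSubmodule_finrank [Fintype σ] (d : ℕ) :
    Module.finrank K (homogeneousSubmodule σ K d) = (Fintype.card σ + d - 1).choose d := by
  classical
  have hset : {f : σ →₀ ℕ | f.degree = d} = ↑(Finset.finsuppAntidiag (Finset.univ : Finset σ) d) := by
    ext f
    simp [Finset.mem_finsuppAntidiag, Finsupp.degree_eq_sum]
  have heq : homogeneousSubmodule σ K d =
      restrictSupport K ↑(Finset.finsuppAntidiag (Finset.univ : Finset σ) d) := by
    rw [homogeneousSubmodule_eq_finsupp_supported, hset]
    rfl
  rw [heq, Module.finrank_eq_card_basis (basisRestrictSupport K _),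
    ← Nat.card_eq_fintype_card, Nat.card_coe_set_eq, Set.ncard_coe_finset,
    Finset.card_finsuppAntidiag_nat_eq_choose, Finset.card_univ]

instance homogeneousSubmodule_finite [Finite σ] (d : ℕ) :
    Module.Finite K (homogeneousSubmodule σ K d) :=
  Module.Finite.iff_fg.mpr (homogeneousSubmodule_fg σ K d)

lemma finrank_binary_forms (d : ℕ) :
    Module.finrank K (homogeneousSubmodule (Fin 2) K d) = d + 1 := by
  rw [homogeneousSubmodule_finrank, Fintype.card_fin, show 2 + d - 1 = d + 1 by omega]
  simp

lemma finrank_ternary_forms (d : ℕ) :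
    Module.finrank K (homogeneousSubmodule (Fin 3) K d) = (d + 2).choose 2 := by
  rw [homogeneousSubmodule_finrank, Fintype.card_fin, show 3 + d - 1 = d + 2 by omega,
    ← Nat.choose_symm (by omega)]
  congr 1
  omega

/-- The homogeneous multiples of degree `d` of the polynomial `q`. -/
noncomputable def homogeneousMultiples (q : MvPolynomial σ K) (d : ℕ) :
    Submodule K (MvPolynomial σ K) where
  carrier := {f | f.IsHomogeneous d ∧ q ∣ f}
  add_mem' := fun ha hb => ⟨ha.1.add hb.1, dvd_add ha.2 hb.2⟩
  zero_mem' := ⟨isHomogeneous_zero _ _ _, dvd_zero _⟩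
  smul_mem' := fun c f hf => ⟨(homogeneousSubmodule σ K d).smul_mem c hf.1, by
    rw [smul_eq_C_mul]; exact hf.2.mul_left _⟩

lemma mem_homogeneousMultiples {q f : MvPolynomial σ K} {d : ℕ} :
    f ∈ homogeneousMultiples q d ↔ f.IsHomogeneous d ∧ q ∣ f := Iff.rfl

lemma homogeneousMultiples_eq_map {q : MvPolynomial σ K} {m : ℕ} (hq : q.IsHomogeneous m)
    (hq0 : q ≠ 0) (e : ℕ) : homogeneousMultiples q (m + e) =
      (homogeneousSubmodule σ K e).map (LinearMap.mulLeft K q) := by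
  ext f
  simp only [mem_homogeneousMultiples, Submodule.mem_map, mem_homogeneousSubmodule,
    LinearMap.mulLeft_apply]
  constructor
  · rintro ⟨hf, g, rfl⟩
    exact ⟨g, isHomogeneous_of_mul_left hq hq0 hf, rfl⟩
  · rintro ⟨g, hg, rfl⟩
    exact ⟨hq.mul hg, dvd_mul_right _ _⟩

lemma finrank_homogeneousMultiples {q : MvPolynomial σ K} {m : ℕ} (hq : q.IsHomogeneous m)
    (hq0 : q ≠ 0) (e : ℕ) : Module.finrank K (homogeneousMultiples q (m + e)) =
      Module.finrank K (homogeneousSubmodule σ K e) := by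
  rw [homogeneousMultiples_eq_map hq hq0]
  exact (Submodule.equivMapOfInjective _ (fun _ _ h => mul_left_cancel₀ hq0 h) _).symm.finrank_eq

lemma homogeneousMultiples_eq_bot {q : MvPolynomial σ K} {m d : ℕ} (hq : q.IsHomogeneous m)
    (hd : d < m) : homogeneousMultiples q d = ⊥ :=
  (Submodule.eq_bot_iff _).mpr fun _ hf => eq_zero_of_dvd_of_lt hq hf.1 hf.2 hd

instance homogeneousMultiples_finite [Finite σ] (q : MvPolynomial σ K) (d : ℕ) :
    Module.Finite K (homogeneousMultiples q d) :=
  Module.Finite.of_injective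
    (Submodule.inclusion (show homogeneousMultiples q d ≤ homogeneousSubmodule σ K d from
      fun _ h => h.1)) (Submodule.inclusion_injective _)

lemma finrank_binary_homogeneousMultiples {q : MvPolynomial (Fin 2) K} {m : ℕ}
    (hq : q.IsHomogeneous m) (hq0 : q ≠ 0) (d : ℕ) :
    Module.finrank K (homogeneousMultiples q d) = d + 1 - m := by
  by_cases hd : d < m
  · rw [homogeneousMultiples_eq_bot hq hd, finrank_bot]
    omega
  · obtain ⟨e, rfl⟩ := Nat.exists_eq_add_of_le (not_lt.mp hd)
    rw [finrank_homogeneousMultiples hq hq0, finrank_binary_forms]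
    omega

end Homogeneous

section LinearForms

variable {σ : Type*} [Fintype σ]

/-- The linear form with coefficient vector `a`. -/
noncomputable def linForm (a : σ → K) : MvPolynomial σ K := ∑ j, C (a j) * X j

lemma linForm_isHomogeneous (a : σ → K) : (linForm a).IsHomogeneous 1 :=
  IsHomogeneous.sum _ _ _ fun j _ => isHomogeneous_C_mul_X (a j) j

lemma linForm_add (a b : σ → K) : linForm (a + b) = linForm a + linForm b := by
  simp [linForm, add_mul, Finset.sum_add_distrib]

lemma linForm_smul (c : K) (a : σ → K) : linForm (c • a) = C c * linForm a := by
  simp [linForm, Finset.mul_sum, mul_assoc]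

lemma linForm_injective : Function.Injective (linForm : (σ → K) → MvPolynomial σ K) := by
  classical
  intro a b h
  ext j
  have h1 := congrArg (coeff (Finsupp.single j 1)) h
  simpa [linForm, coeff_sum, coeff_C_mul, coeff_X, Finsupp.single_left_inj] using h1

lemma linForm_ne_zero {a : σ → K} (ha : a ≠ 0) : linForm a ≠ 0 := fun h =>
  ha (linForm_injective (h.trans (by simp [linForm])))

lemma linForm_irreducible {a : σ → K} (ha : a ≠ 0) : Irreducible (linForm a) := by
  refine irreducible_of_totalDegree_eq_one
    ((linForm_isHomogeneous a).totalDegree (linForm_ne_zero ha)) fun x hx => ?_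
  obtain ⟨i, hi⟩ := MvPolynomial.ne_zero_iff.mp (linForm_ne_zero ha)
  refine isUnit_iff_ne_zero.mpr fun h0 => hi ?_
  simpa [h0] using hx i

lemma eq_smul_of_linForm_dvd {a b : σ → K} (ha : a ≠ 0) (h : linForm a ∣ linForm b) :
    ∃ c : K, b = c • a := by
  obtain ⟨g, hg⟩ := h
  have hom := linForm_isHomogeneous b
  rw [hg] at hom
  have h0 := isHomogeneous_of_mul_left (n := 0) (linForm_isHomogeneous a) (linForm_ne_zero ha) hom
  obtain ⟨c, rfl⟩ : ∃ c, g = C c :=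
    ⟨_, totalDegree_eq_zero_iff_eq_C.mp (Nat.le_zero.mp h0.totalDegree_le)⟩
  exact ⟨_, linForm_injective (by rw [hg, linForm_smul, mul_comm])⟩

lemma linForm_isRelPrime {a b : σ → K} (ha : a ≠ 0) (h : ∀ c : K, b ≠ c • a) :
    IsRelPrime (linForm a) (linForm b) :=
  (linForm_irreducible ha).isRelPrime_iff_not_dvd.mpr fun hd =>
    let ⟨c, hc⟩ := eq_smul_of_linForm_dvd ha hd
    h c hc

lemma isHomogeneous_prod_linForm {ι : Type*} (s : Finset ι) (f : ι → σ → K) :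
    (∏ i ∈ s, linForm (f i)).IsHomogeneous s.card := by
  simpa using IsHomogeneous.prod s (fun i => linForm (f i)) (fun _ => 1)
    fun i _ => linForm_isHomogeneous (f i)

end LinearForms

section BinaryForms

/-- The determinant of two vectors of the plane. -/
def det₂ (p q : Fin 2 → K) : K := p 0 * q 1 - p 1 * q 0

lemma ne_smul_of_det₂_ne_zero {p q : Fin 2 → K} (h : det₂ p q ≠ 0) (c : K) : q ≠ c • p := by
  rintro rfl
  apply h
  simp only [det₂, Pi.smul_apply, smul_eq_mul]
  ring

lemma linForm_fin_two (p : Fin 2 → K) : linForm p = C (p 0) * X 0 + C (p 1) * X 1 := by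
  simp [linForm, Fin.sum_univ_two]

lemma idealOfVars_le_of_det₂_ne_zero {p q : Fin 2 → K} (h : det₂ p q ≠ 0)
    {I : Ideal (MvPolynomial (Fin 2) K)} (hp : linForm p ∈ I) (hq : linForm q ∈ I) :
    idealOfVars (Fin 2) K ≤ I := by
  have hd : (C (det₂ p q)⁻¹ * C (det₂ p q) : MvPolynomial (Fin 2) K) = 1 := by
    rw [← C_mul, inv_mul_cancel₀ h, C_1]
  have e : (C (det₂ p q) : MvPolynomial (Fin 2) K) = C (p 0) * C (q 1) - C (p 1) * C (q 0) := by
    simp [det₂]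
  rw [e] at hd
  rw [linForm_fin_two] at hp hq
  rw [idealOfVars, Ideal.span_le]
  rintro _ ⟨j, rfl⟩
  have h0 : X 0 ∈ I := by
    have := I.mul_mem_left (C (det₂ p q)⁻¹)
      (I.sub_mem (I.mul_mem_left (C (q 1)) hp) (I.mul_mem_left (C (p 1)) hq))
    convert this using 1
    linear_combination -(X 0) * hd
  have h1 : X 1 ∈ I := by
    have := I.mul_mem_left (C (det₂ p q)⁻¹)
      (I.sub_mem (I.mul_mem_left (C (p 0)) hq) (I.mul_mem_left (C (q 0)) hp))
    convert this using 1
    linear_combination -(X 1) * hd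
  fin_cases j
  exacts [h0, h1]

open Classical in
lemma idealOfVars_pow_le_of_prod_erase_mem (n : ℕ) :
    ∀ (T : Finset (Fin 2 → K)), T.card = n + 1 →
    (∀ p ∈ T, ∀ q ∈ T, p ≠ q → det₂ p q ≠ 0) → ∀ (I : Ideal (MvPolynomial (Fin 2) K)),
    (∀ p ∈ T, ∏ q ∈ T.erase p, linForm q ∈ I) → idealOfVars (Fin 2) K ^ n ≤ I := by
  induction n with
  | zero =>
    intro T hT _ I hI
    obtain ⟨p, rfl⟩ := Finset.card_eq_one.mp hT
    have := hI p (by simp)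
    simp only [Finset.erase_singleton, Finset.prod_empty] at this
    rw [(Ideal.eq_top_iff_one I).mpr this]
    exact le_top
  | succ n ih =>
    intro T hT hdet I hI
    have key : ∀ p ∈ T, ∀ f ∈ idealOfVars (Fin 2) K ^ n, linForm p * f ∈ I := by
      intro p hp f hf
      have h1 := ih (T.erase p) (by rw [Finset.card_erase_of_mem hp]; omega)
        (fun a ha b hb => hdet a (Finset.mem_of_mem_erase ha) b (Finset.mem_of_mem_erase hb))
        (Submodule.comap (LinearMap.mulLeft (MvPolynomial (Fin 2) K) (linForm p)) I) ?_
      · exact h1 hf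
      · intro q hq
        change linForm p * _ ∈ I
        have hpq : p ∈ T.erase q := Finset.mem_erase.mpr ⟨(Finset.ne_of_mem_erase hq).symm, hp⟩
        rw [Finset.erase_right_comm, Finset.mul_prod_erase _ _ hpq]
        exact hI q (Finset.mem_of_mem_erase hq)
    obtain ⟨p, hp, q, hq, hpq⟩ := Finset.one_lt_card.mp (by omega : 1 < T.card)
    rw [pow_succ', Ideal.mul_le]
    intro x hx f hf
    have := idealOfVars_le_of_det₂_ne_zero (hdet p hp q hq hpq)
      (I := Submodule.comap (LinearMap.mulRight (MvPolynomial (Fin 2) K) f) I)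
       (key p hp f hf) (key q hq f hf)
    exact this hx

lemma isHomogeneous_mem_idealOfVars_pow {f : MvPolynomial (Fin 2) K} {d n : ℕ}
    (hf : f.IsHomogeneous d) (h : n ≤ d) : f ∈ idealOfVars (Fin 2) K ^ n := by
  rw [mem_pow_idealOfVars_iff']
  intro x hx
  exact hf.coeff_eq_zero (by omega)

/-- The multiple of a nonzero vector of the plane whose first nonzero coordinate is `1`. -/
noncomputable def normalized (p : Fin 2 → K) : Fin 2 → K :=
  open Classical in if p 0 = 0 then ![0, 1] else ![1, p 1 / p 0]

/-- The factor by which `p` differs from `normalized p`. -/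
noncomputable def leadingCoord (p : Fin 2 → K) : K :=
  open Classical in if p 0 = 0 then p 1 else p 0

lemma leadingCoord_ne_zero {p : Fin 2 → K} (hp : p ≠ 0) : leadingCoord p ≠ 0 := by
  unfold leadingCoord
  split_ifs with h
  · intro h1
    apply hp
    ext j
    fin_cases j
    exacts [h, h1]
  · exact h

lemma leadingCoord_smul_normalized (p : Fin 2 → K) : leadingCoord p • normalized p = p := by
  unfold leadingCoord normalized
  ext j
  split_ifs with h <;> fin_cases j <;> simp [h]
  field_simp

lemma normalized_ne_zero (p : Fin 2 → K) : normalized p ≠ 0 := by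
  unfold normalized
  split_ifs
  · exact fun h => one_ne_zero (congrFun h 1)
  · exact fun h => one_ne_zero (congrFun h 0)

lemma linForm_eq_normalized (p : Fin 2 → K) :
    linForm p = C (leadingCoord p) * linForm (normalized p) := by
  rw [← linForm_smul, leadingCoord_smul_normalized]

lemma det₂_normalized_ne_zero {p q : Fin 2 → K} (h : normalized p ≠ normalized q) :
    det₂ (normalized p) (normalized q) ≠ 0 := by
  intro h0
  apply h
  unfold normalized at *
  unfold det₂ at h0
  split_ifs at h h0 ⊢ <;> simp_all [sub_eq_zero]

end BinaryForms

section Restriction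

lemma homogeneousComponent_aeval {σ τ : Type*} {g : σ → MvPolynomial τ K}
    (hg : ∀ i, (g i).IsHomogeneous 1) (f : MvPolynomial σ K) (d : ℕ) :
    homogeneousComponent d (aeval g f) = aeval g (homogeneousComponent d f) := by
  classical
  conv_lhs => rw [← sum_homogeneousComponent f, map_sum, map_sum]
  have h : ∀ i, homogeneousComponent d (aeval g (homogeneousComponent i f))
      = if d = i then aeval g (homogeneousComponent i f) else 0 := by
    intro i
    have := (homogeneousComponent_isHomogeneous i f).aeval g hg
    rw [one_mul] at this
    rw [homogeneousComponent_of_mem this]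
  simp only [h, Finset.sum_ite_eq, Finset.mem_range]
  split_ifs with hn
  · rfl
  · rw [homogeneousComponent_eq_zero _ _ (by omega), map_zero]

/-- A basis `e, u, v` of `K³` adapted to the plane `a = 0`, which is spanned by `u` and `v`,
together with the last two members of the dual basis `a, b₀, b₁`. -/
structure PlaneFrame (a : Fin 3 → K) where
  e : Fin 3 → K
  u : Fin 3 → K
  v : Fin 3 → K
  b₀ : Fin 3 → K
  b₁ : Fin 3 → K
  a_e : a ⬝ᵥ e = 1
  a_u : a ⬝ᵥ u = 0
  a_v : a ⬝ᵥ v = 0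
  b₀_u : b₀ ⬝ᵥ u = 1
  b₀_v : b₀ ⬝ᵥ v = 0
  b₁_u : b₁ ⬝ᵥ u = 0
  b₁_v : b₁ ⬝ᵥ v = 1
  decomp : ∀ c : Fin 3 → K, c = (c ⬝ᵥ e) • a + (c ⬝ᵥ u) • b₀ + (c ⬝ᵥ v) • b₁

namespace PlaneFrame

variable {a : Fin 3 → K} (F : PlaneFrame a)

/-- The restriction of a linear form to the plane. -/
def restr (c : Fin 3 → K) : Fin 2 → K := ![c ⬝ᵥ F.u, c ⬝ᵥ F.v]

/-- The restriction of a polynomial to the plane. -/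
noncomputable def res : MvPolynomial (Fin 3) K →ₐ[K] MvPolynomial (Fin 2) K :=
  aeval fun j => linForm ![F.u j, F.v j]

/-- The extension of a polynomial on the plane to `K³`. -/
noncomputable def ext : MvPolynomial (Fin 2) K →ₐ[K] MvPolynomial (Fin 3) K :=
  aeval ![linForm F.b₀, linForm F.b₁]

lemma res_linForm (c : Fin 3 → K) : F.res (linForm c) = linForm (F.restr c) := by
  simp only [linForm, res, restr, Fin.sum_univ_two, Fin.sum_univ_three, map_add, map_mul, aeval_X,
    algHom_C, algebraMap_eq, Matrix.cons_val_zero, Matrix.cons_val_one, dotProduct]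
  ring

lemma restr_a : F.restr a = 0 := by
  ext j
  fin_cases j
  exacts [F.a_u, F.a_v]

lemma res_a : F.res (linForm a) = 0 := by
  rw [res_linForm, restr_a]
  simp [linForm]

lemma restr_b₀ : F.restr F.b₀ = ![1, 0] := by simp [restr, F.b₀_u, F.b₀_v]

lemma restr_b₁ : F.restr F.b₁ = ![0, 1] := by simp [restr, F.b₁_u, F.b₁_v]

lemma res_b₀ : F.res (linForm F.b₀) = X 0 := by
  rw [res_linForm, restr_b₀]
  simp [linForm]

lemma res_b₁ : F.res (linForm F.b₁) = X 1 := by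
  rw [res_linForm, restr_b₁]
  simp [linForm]

lemma restr_add (c d : Fin 3 → K) : F.restr (c + d) = F.restr c + F.restr d := by
  ext j
  fin_cases j <;> simp [restr, add_dotProduct]

lemma restr_smul (k : K) (c : Fin 3 → K) : F.restr (k • c) = k • F.restr c := by
  ext j
  fin_cases j <;> simp [restr]

lemma eq_smul_of_restr_eq_zero {c : Fin 3 → K} (h : F.restr c = 0) : c = (c ⬝ᵥ F.e) • a := by
  have h0 : c ⬝ᵥ F.u = 0 := congrFun h 0
  have h1 : c ⬝ᵥ F.v = 0 := congrFun h 1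
  conv_lhs => rw [F.decomp c, h0, h1]
  simp

lemma restr_ne_zero {c : Fin 3 → K} (h : ∀ k : K, c ≠ k • a) : F.restr c ≠ 0 := fun h0 =>
  h _ (F.eq_smul_of_restr_eq_zero h0)

lemma a_ne_zero {a : Fin 3 → K} (F : PlaneFrame a) : a ≠ 0 := by
  rintro rfl
  simpa using F.a_e

lemma res_ext (f : MvPolynomial (Fin 2) K) : F.res (F.ext f) = f := by
  have : (F.res.comp F.ext) = AlgHom.id K _ := by
    apply MvPolynomial.algHom_ext
    intro j
    fin_cases j
    · simpa [ext] using F.res_b₀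
    · simpa [ext] using F.res_b₁
  exact DFunLike.congr_fun this f

lemma X_eq (j : Fin 3) : (X j : MvPolynomial (Fin 3) K) =
    C (F.e j) * linForm a + C (F.u j) * linForm F.b₀ + C (F.v j) * linForm F.b₁ := by
  have h := F.decomp (Pi.single j 1)
  simp only [single_one_dotProduct] at h
  rw [← linForm_smul, ← linForm_smul, ← linForm_smul, ← linForm_add, ← linForm_add, ← h]
  simp [linForm, Pi.single_apply]

lemma dvd_sub_ext_res (f : MvPolynomial (Fin 3) K) : linForm a ∣ f - F.ext (F.res f) := by
  rw [← Ideal.mem_span_singleton, ← Ideal.Quotient.eq]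
  have : (Ideal.Quotient.mkₐ K (Ideal.span {linForm a})) =
      (Ideal.Quotient.mkₐ K (Ideal.span {linForm a})).comp (F.ext.comp F.res) := by
    apply MvPolynomial.algHom_ext
    intro j
    simp only [AlgHom.comp_apply, Ideal.Quotient.mkₐ_eq_mk]
    rw [Ideal.Quotient.eq, Ideal.mem_span_singleton]
    refine ⟨C (F.e j), ?_⟩
    conv_lhs => enter [1]; rw [F.X_eq j]
    simp [res, ext, linForm_fin_two, algebraMap_eq]
    ring
  exact DFunLike.congr_fun this f

lemma res_eq_zero_iff (f : MvPolynomial (Fin 3) K) : F.res f = 0 ↔ linForm a ∣ f := by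
  constructor
  · intro h
    simpa [h] using F.dvd_sub_ext_res f
  · rintro ⟨g, rfl⟩
    rw [map_mul, res_a, zero_mul]

lemma res_isHomogeneous {f : MvPolynomial (Fin 3) K} {d : ℕ} (hf : f.IsHomogeneous d) :
    (F.res f).IsHomogeneous d := by
  have := hf.aeval (fun j => linForm ![F.u j, F.v j]) fun j => linForm_isHomogeneous _
  rwa [one_mul] at this

lemma res_homogeneousComponent (f : MvPolynomial (Fin 3) K) (d : ℕ) :
    F.res (homogeneousComponent d f) = homogeneousComponent d (F.res f) :=
  (homogeneousComponent_aeval (fun _ => linForm_isHomogeneous _) f d).symm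

lemma exists_dotProduct_eq {a : Fin 3 → K} (F : PlaneFrame a) {c : Fin 3 → K} (h : ∀ k : K, c ≠ k • a) :
    ∃ w : Fin 3 → K, c ⬝ᵥ w = 0 ∧ a ⬝ᵥ w = 1 := by
  have h0 := F.restr_ne_zero h
  by_cases hu : c ⬝ᵥ F.u = 0
  · have hv : c ⬝ᵥ F.v ≠ 0 := by
      intro hv
      exact h0 (by ext j; fin_cases j; exacts [hu, hv])
    refine ⟨F.e - (c ⬝ᵥ F.e / c ⬝ᵥ F.v) • F.v, ?_, ?_⟩
    · rw [dotProduct_sub, dotProduct_smul, smul_eq_mul]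
      field_simp
      ring
    · rw [dotProduct_sub, dotProduct_smul, F.a_v, F.a_e]
      simp
  · refine ⟨F.e - (c ⬝ᵥ F.e / c ⬝ᵥ F.u) • F.u, ?_, ?_⟩
    · rw [dotProduct_sub, dotProduct_smul, smul_eq_mul]
      field_simp
      ring
    · rw [dotProduct_sub, dotProduct_smul, F.a_u, F.a_e]
      simp

end PlaneFrame

end Restriction

section LogDer

/-- The value of a derivation of `K[x,y,z]` at the linear form with coefficients `c`. -/
noncomputable def derApply (c : Fin 3 → K) :
    (Fin 3 → MvPolynomial (Fin 3) K) →ₗ[MvPolynomial (Fin 3) K] MvPolynomial (Fin 3) K :=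
  ∑ j, (C (c j) : MvPolynomial (Fin 3) K) • LinearMap.proj (R := MvPolynomial (Fin 3) K)
    (φ := fun _ : Fin 3 => MvPolynomial (Fin 3) K) j

lemma derApply_apply (c : Fin 3 → K) (θ : Fin 3 → MvPolynomial (Fin 3) K) :
    derApply c θ = ∑ j, C (c j) * θ j := by
  simp [derApply]

lemma derApply_add (c d : Fin 3 → K) (θ : Fin 3 → MvPolynomial (Fin 3) K) :
    derApply (c + d) θ = derApply c θ + derApply d θ := by
  simp [derApply_apply, add_mul, Finset.sum_add_distrib]

lemma derApply_smul (k : K) (c : Fin 3 → K) (θ : Fin 3 → MvPolynomial (Fin 3) K) :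
    derApply (k • c) θ = C k * derApply c θ := by
  simp [derApply_apply, Finset.mul_sum, mul_assoc]

lemma derApply_X (c : Fin 3 → K) : derApply c X = linForm c := by
  simp [derApply_apply, linForm]

lemma derApply_const (c w : Fin 3 → K) (f : MvPolynomial (Fin 3) K) :
    derApply c (fun j => C (w j) * f) = C (c ⬝ᵥ w) * f := by
  simp [derApply_apply, dotProduct, Finset.sum_mul, mul_assoc]

/-- The derivations of `K[x,y,z]` with homogeneous coefficients of degree `d`. -/
noncomputable def homogDer (d : ℕ) : Submodule K (Fin 3 → MvPolynomial (Fin 3) K) :=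
  Submodule.pi Set.univ fun _ => homogeneousSubmodule (Fin 3) K d

lemma mem_homogDer {d : ℕ} {θ : Fin 3 → MvPolynomial (Fin 3) K} :
    θ ∈ homogDer d ↔ ∀ j, (θ j).IsHomogeneous d := by
  simp [homogDer, Submodule.mem_pi]

/-- The space of homogeneous derivations as a product. -/
noncomputable def homogDerEquiv (d : ℕ) :
    homogDer (K := K) d ≃ₗ[K] (Fin 3 → homogeneousSubmodule (Fin 3) K d) where
  toFun θ j := ⟨θ.1 j, mem_homogDer.mp θ.2 j⟩
  invFun f := ⟨fun j => f j, mem_homogDer.mpr fun j => (f j).2⟩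
  map_add' _ _ := rfl
  map_smul' _ _ := rfl
  left_inv _ := rfl
  right_inv _ := rfl

instance homogDer_finite (d : ℕ) : Module.Finite K (homogDer (K := K) d) :=
  Module.Finite.equiv (homogDerEquiv d).symm

lemma finrank_homogDer (d : ℕ) :
    Module.finrank K (homogDer (K := K) d) = 3 * (d + 2).choose 2 := by
  rw [(homogDerEquiv d).finrank_eq, Module.finrank_pi_fintype]
  simp [finrank_ternary_forms]

lemma derApply_isHomogeneous {d : ℕ} {θ : Fin 3 → MvPolynomial (Fin 3) K} (hθ : θ ∈ homogDer d)
    (c : Fin 3 → K) : (derApply c θ).IsHomogeneous d := by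
  rw [derApply_apply]
  exact IsHomogeneous.sum _ _ _ fun j _ => (mem_homogDer.mp hθ j).C_mul (c j)

lemma derApply_homogeneousComponent (d : ℕ) (c : Fin 3 → K) (θ : Fin 3 → MvPolynomial (Fin 3) K) :
    derApply c (fun j => homogeneousComponent d (θ j)) =
      homogeneousComponent d (derApply c θ) := by
  simp [derApply_apply, homogeneousComponent_C_mul]

variable {ι : Type*}

/-- The logarithmic derivations of the central arrangement with defining forms `α i`, `i ∈ s`. -/
noncomputable def logDer (s : Finset ι) (α : ι → Fin 3 → K) :
    Submodule (MvPolynomial (Fin 3) K) (Fin 3 → MvPolynomial (Fin 3) K) where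
  carrier := {θ | ∀ i ∈ s, linForm (α i) ∣ derApply (α i) θ}
  add_mem' := fun h₁ h₂ i hi => by
    rw [map_add]
    exact dvd_add (h₁ i hi) (h₂ i hi)
  zero_mem' := fun i _ => by
    rw [map_zero]
    exact dvd_zero _
  smul_mem' := fun c θ h i hi => by
    rw [map_smul, smul_eq_mul]
    exact (h i hi).mul_left c

lemma mem_logDer {s : Finset ι} {α : ι → Fin 3 → K} {θ : Fin 3 → MvPolynomial (Fin 3) K} :
    θ ∈ logDer s α ↔ ∀ i ∈ s, linForm (α i) ∣ derApply (α i) θ := Iff.rfl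

lemma homogeneousComponent_mem_logDer {s : Finset ι} {α : ι → Fin 3 → K}
    {θ : Fin 3 → MvPolynomial (Fin 3) K} (h : θ ∈ logDer s α) (d : ℕ) :
    (fun j => homogeneousComponent d (θ j)) ∈ logDer s α := by
  intro i hi
  rw [derApply_homogeneousComponent]
  exact dvd_homogeneousComponent (linForm_isHomogeneous _) (h i hi) d

lemma X_mem_logDer (s : Finset ι) (α : ι → Fin 3 → K) : X ∈ logDer s α := fun i _ => by
  rw [derApply_X]

/-- The homogeneous logarithmic derivations of degree `d`. -/
noncomputable def logDerDeg (s : Finset ι) (α : ι → Fin 3 → K) (d : ℕ) :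
    Submodule K (Fin 3 → MvPolynomial (Fin 3) K) :=
  (logDer s α).restrictScalars K ⊓ homogDer d

lemma mem_logDerDeg {s : Finset ι} {α : ι → Fin 3 → K} {d : ℕ}
    {θ : Fin 3 → MvPolynomial (Fin 3) K} :
    θ ∈ logDerDeg s α d ↔ θ ∈ logDer s α ∧ θ ∈ homogDer d := Iff.rfl

instance logDerDeg_finite (s : Finset ι) (α : ι → Fin 3 → K) (d : ℕ) :
    Module.Finite K (logDerDeg s α d) :=
  Submodule.finiteDimensional_of_le (inf_le_right : logDerDeg s α d ≤ homogDer d)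

/-- The forms `α i`, `i ∈ s`, are nonzero and pairwise not proportional. -/
def IsCentralArr (s : Finset ι) (α : ι → Fin 3 → K) : Prop :=
  (∀ i ∈ s, α i ≠ 0) ∧ ∀ i ∈ s, ∀ j ∈ s, i ≠ j → ∀ c : K, α j ≠ c • α i

lemma IsCentralArr.mono {s t : Finset ι} {α : ι → Fin 3 → K} (h : IsCentralArr t α) (hst : s ⊆ t) :
    IsCentralArr s α :=
  ⟨fun i hi => h.1 i (hst hi), fun i hi j hj => h.2 i (hst hi) j (hst hj)⟩

lemma IsCentralArr.prod_dvd {s : Finset ι} {α : ι → Fin 3 → K} (h : IsCentralArr s α)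
    {z : MvPolynomial (Fin 3) K} (hz : ∀ i ∈ s, linForm (α i) ∣ z) :
    ∏ i ∈ s, linForm (α i) ∣ z :=
  Finset.prod_dvd_of_isRelPrime
    (fun i hi j hj hij => linForm_isRelPrime (h.1 i hi) (h.2 i hi j hj hij)) hz

lemma finrank_map_add_finrank_inf_ker {V U : Type*} [AddCommGroup V] [Module K V]
    [AddCommGroup U] [Module K U] (W : Submodule K V) [Module.Finite K W] (f : V →ₗ[K] U) :
    Module.finrank K (W.map f) + Module.finrank K (W ⊓ LinearMap.ker f : Submodule K V) =
      Module.finrank K W := by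
  rw [← LinearMap.finrank_range_add_finrank_ker (f.domRestrict W), LinearMap.range_domRestrict,
    LinearMap.ker_domRestrict, ← Submodule.map_comap_subtype]
  exact congrArg _ (Submodule.finrank_map_subtype_eq W _)

end LogDer

section Addition

namespace PlaneFrame

variable {ι : Type*} {a : Fin 3 → K} (F : PlaneFrame a)

open Classical in
/-- The points cut out on the plane `a = 0`, regarded as a projective line, by the planes
`α i = 0`, `i ∈ s`. -/
noncomputable def pts (s : Finset ι) (α : ι → Fin 3 → K) : Finset (Fin 2 → K) :=
  s.image fun i => normalized (F.restr (α i))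

open Classical in
/-- The number of the planes `α i = 0`, `i ∈ s`, through the point `p` of the plane `a = 0`. -/
noncomputable def mult (s : Finset ι) (α : ι → Fin 3 → K) (p : Fin 2 → K) : ℕ :=
  (s.filter fun i => normalized (F.restr (α i)) = p).card

/-- Ziegler's polynomial of the multirestriction, with all multiplicities lowered by one. -/
noncomputable def multPoly (s : Finset ι) (α : ι → Fin 3 → K) : MvPolynomial (Fin 2) K :=
  ∏ p ∈ F.pts s α, linForm p ^ (F.mult s α p - 1)

variable {s : Finset ι} {α : ι → Fin 3 → K}

lemma mem_pts {p : Fin 2 → K} : p ∈ F.pts s α ↔ ∃ i ∈ s, normalized (F.restr (α i)) = p := by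
  simp [pts]

lemma card_pts_le : (F.pts s α).card ≤ s.card := by
  classical
  exact Finset.card_image_le

lemma ne_zero_of_mem_pts {p : Fin 2 → K} (hp : p ∈ F.pts s α) : p ≠ 0 := by
  obtain ⟨i, -, rfl⟩ := F.mem_pts.mp hp
  exact normalized_ne_zero _

lemma det₂_ne_zero_of_mem_pts {p q : Fin 2 → K} (hp : p ∈ F.pts s α) (hq : q ∈ F.pts s α)
    (h : p ≠ q) : det₂ p q ≠ 0 := by
  obtain ⟨i, -, rfl⟩ := F.mem_pts.mp hp
  obtain ⟨j, -, rfl⟩ := F.mem_pts.mp hq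
  exact det₂_normalized_ne_zero h

lemma isRelPrime_of_mem_pts {p q : Fin 2 → K} (hp : p ∈ F.pts s α) (hq : q ∈ F.pts s α)
    (h : p ≠ q) : IsRelPrime (linForm p) (linForm q) :=
  linForm_isRelPrime (F.ne_zero_of_mem_pts hp)
    (ne_smul_of_det₂_ne_zero (F.det₂_ne_zero_of_mem_pts hp hq h))

lemma one_le_mult {p : Fin 2 → K} (hp : p ∈ F.pts s α) : 1 ≤ F.mult s α p := by
  classical
  obtain ⟨i, hi, h⟩ := F.mem_pts.mp hp
  exact Finset.card_pos.mpr ⟨i, Finset.mem_filter.mpr ⟨hi, h⟩⟩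

lemma multPoly_isHomogeneous :
    (F.multPoly s α).IsHomogeneous (s.card - (F.pts s α).card) := by
  classical
  have h : ∑ p ∈ F.pts s α, (F.mult s α p - 1) = s.card - (F.pts s α).card := by
    have h1 : ∑ p ∈ F.pts s α, F.mult s α p = s.card :=
      (Finset.card_eq_sum_card_image _ s).symm
    have h2 : ∑ p ∈ F.pts s α, (F.mult s α p - 1 + 1) = s.card := by
      rw [← h1]
      exact Finset.sum_congr rfl fun p hp => Nat.sub_add_cancel (F.one_le_mult hp)
    rw [Finset.sum_add_distrib, Finset.sum_const, smul_eq_mul, mul_one] at h2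
    omega
  rw [← h]
  refine IsHomogeneous.prod _ _ _ fun p _ => ?_
  simpa using (linForm_isHomogeneous p).pow (F.mult s α p - 1)

lemma multPoly_ne_zero : F.multPoly s α ≠ 0 :=
  Finset.prod_ne_zero_iff.mpr fun _ hp => pow_ne_zero _ (linForm_ne_zero (F.ne_zero_of_mem_pts hp))

lemma multPoly_dvd {f : MvPolynomial (Fin 2) K}
    (h : ∀ p ∈ F.pts s α, linForm p ^ (F.mult s α p - 1) ∣ f) : F.multPoly s α ∣ f :=
  Finset.prod_dvd_of_isRelPrime
    (fun _ hp _ hq hpq => (F.isRelPrime_of_mem_pts hp hq hpq).pow) h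

lemma prod_pts_dvd {f : MvPolynomial (Fin 2) K} (h : ∀ p ∈ F.pts s α, linForm p ∣ f) :
    ∏ p ∈ F.pts s α, linForm p ∣ f :=
  Finset.prod_dvd_of_isRelPrime (fun _ hp _ hq hpq => F.isRelPrime_of_mem_pts hp hq hpq) h

lemma prod_linForm_restr :
    ∏ i ∈ s, linForm (F.restr (α i)) = C (∏ i ∈ s, leadingCoord (F.restr (α i))) *
      (F.multPoly s α * ∏ p ∈ F.pts s α, linForm p) := by
  classical
  have h : ∏ i ∈ s, linForm (normalized (F.restr (α i))) =
      F.multPoly s α * ∏ p ∈ F.pts s α, linForm p := by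
    rw [Finset.prod_comp, multPoly, ← Finset.prod_mul_distrib]
    refine Finset.prod_congr rfl fun p hp => ?_
    rw [← pow_succ, Nat.sub_add_cancel (F.one_le_mult hp)]
    rfl
  rw [← h, map_prod, ← Finset.prod_mul_distrib]
  exact Finset.prod_congr rfl fun i _ => linForm_eq_normalized _

lemma pow_mult_dvd_res (hs : IsCentralArr s α) {p : Fin 2 → K} {z : MvPolynomial (Fin 3) K}
    (hz : ∀ i ∈ s, normalized (F.restr (α i)) = p → linForm (α i) ∣ z) :
    linForm p ^ F.mult s α p ∣ F.res z := by
  classical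
  have h := map_dvd F.res ((hs.mono (Finset.filter_subset
    (fun i => normalized (F.restr (α i)) = p) s)).prod_dvd fun i hi =>
      hz i (Finset.mem_filter.mp hi).1 (Finset.mem_filter.mp hi).2)
  refine dvd_trans ?_ h
  rw [map_prod, mult, ← Finset.prod_const]
  refine Finset.prod_dvd_prod_of_dvd _ _ fun i hi => ?_
  rw [res_linForm, linForm_eq_normalized (F.restr _), (Finset.mem_filter.mp hi).2]
  exact dvd_mul_left _ _

lemma exists_eq_smul_add_smul {c d : Fin 3 → K} (hd : F.restr d ≠ 0)
    (h : normalized (F.restr c) = normalized (F.restr d)) :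
    ∃ k l : K, c = k • d + l • a := by
  refine ⟨leadingCoord (F.restr c) / leadingCoord (F.restr d),
    (c - (leadingCoord (F.restr c) / leadingCoord (F.restr d)) • d) ⬝ᵥ F.e, ?_⟩
  rw [← F.eq_smul_of_restr_eq_zero, add_sub_cancel]
  rw [sub_eq_add_neg, ← neg_smul, restr_add, restr_smul]
  have hc := leadingCoord_smul_normalized (F.restr c)
  have hd' := leadingCoord_smul_normalized (F.restr d)
  have hd0 := leadingCoord_ne_zero hd
  rw [h] at hc
  generalize leadingCoord (F.restr c) = x at *
  generalize leadingCoord (F.restr d) = y at *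
  generalize normalized (F.restr d) = m at *
  rw [← hc, ← hd', smul_smul, ← add_smul, neg_mul, div_mul_cancel₀ _ hd0, add_neg_cancel,
    zero_smul]

lemma multPoly_dvd_res_derApply (hs : IsCentralArr s α) (hne : ∀ i ∈ s, ∀ c : K, α i ≠ c • a)
    {θ : Fin 3 → MvPolynomial (Fin 3) K} (hθ : θ ∈ logDer s α) :
    F.multPoly s α ∣ F.res (derApply a θ) := by
  refine F.multPoly_dvd fun p hp => ?_
  obtain ⟨i, hi, hip⟩ := F.mem_pts.mp hp
  have hi0 := F.restr_ne_zero (hne i hi)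
  have h := F.pow_mult_dvd_res hs (p := p)
    (z := linForm (α i) * derApply a θ - linForm a * derApply (α i) θ) fun j hj hjp => ?_
  · rw [map_sub, map_mul, map_mul, res_a, zero_mul, sub_zero, res_linForm,
      linForm_eq_normalized (F.restr _), hip, mul_assoc, ← Nat.sub_add_cancel (F.one_le_mult hp), pow_succ'] at h
    have hu : IsUnit (C (leadingCoord (F.restr (α i))) : MvPolynomial (Fin 2) K) :=
      (isUnit_iff_ne_zero.mpr (leadingCoord_ne_zero hi0)).map C
    rw [hu.dvd_mul_left] at h
    exact (mul_dvd_mul_iff_left (linForm_ne_zero (F.ne_zero_of_mem_pts hp))).mp h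
  · obtain ⟨k, l, hkl⟩ := F.exists_eq_smul_add_smul hi0 (hjp.trans hip.symm)
    have hk : k ≠ 0 := by
      rintro rfl
      exact hne j hj l (by simpa using hkl)
    have hu : IsUnit (C k : MvPolynomial (Fin 3) K) := (isUnit_iff_ne_zero.mpr hk).map C
    rw [← hu.dvd_mul_left]
    have e : C k * (linForm (α i) * derApply a θ - linForm a * derApply (α i) θ) =
        linForm (α j) * derApply a θ - linForm a * derApply (α j) θ := by
      rw [hkl, linForm_add, linForm_smul, linForm_smul, derApply_add, derApply_smul, derApply_smul]
      ring
    rw [e]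
    exact dvd_sub (dvd_mul_right _ _) ((hθ j hj).mul_left _)

/-- The quotients by `multPoly` of the values at `a` of logarithmic derivations, restricted to the
plane `a = 0`. -/
noncomputable def quotIdeal (s : Finset ι) (α : ι → Fin 3 → K) :
    Ideal (MvPolynomial (Fin 2) K) where
  carrier := {g | ∃ θ ∈ logDer s α, F.res (derApply a θ) = F.multPoly s α * g}
  add_mem' := by
    rintro g₁ g₂ ⟨θ₁, h₁, e₁⟩ ⟨θ₂, h₂, e₂⟩
    exact ⟨θ₁ + θ₂, add_mem h₁ h₂, by rw [map_add, map_add, e₁, e₂, mul_add]⟩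
  zero_mem' := ⟨0, zero_mem _, by simp⟩
  smul_mem' := by
    rintro c g ⟨θ, h, e⟩
    refine ⟨F.ext c • θ, Submodule.smul_mem _ _ h, ?_⟩
    rw [map_smul, smul_eq_mul, map_mul, res_ext, e, smul_eq_mul]
    ring

lemma prod_erase_mem_logDer [DecidableEq ι] {i : ι} {w : Fin 3 → K} (hw : α i ⬝ᵥ w = 0) :
    (fun j => C (w j) * ∏ l ∈ s.erase i, linForm (α l)) ∈ logDer s α := by
  intro l hl
  rw [derApply_const]
  by_cases h : l = i
  · rw [h, hw]
    simp
  · exact (Finset.dvd_prod_of_mem _ (Finset.mem_erase.mpr ⟨h, hl⟩)).mul_left _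

open Classical in
lemma prod_pts_erase_mem_quotIdeal (hne : ∀ i ∈ s, ∀ c : K, α i ≠ c • a) {p : Fin 2 → K}
    (hp : p ∈ F.pts s α) : ∏ q ∈ (F.pts s α).erase p, linForm q ∈ F.quotIdeal s α := by
  obtain ⟨i, hi, hip⟩ := F.mem_pts.mp hp
  obtain ⟨w, hw0, hw1⟩ := F.exists_dotProduct_eq (hne i hi)
  set k := ∏ i ∈ s, leadingCoord (F.restr (α i)) with hk
  have hk0 : k ≠ 0 := Finset.prod_ne_zero_iff.mpr fun j hj =>
    leadingCoord_ne_zero (F.restr_ne_zero (hne j hj))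
  have hl0 := leadingCoord_ne_zero (F.restr_ne_zero (hne i hi))
  have key : C (leadingCoord (F.restr (α i))) * ∏ j ∈ s.erase i, linForm (F.restr (α j)) =
      C k * (F.multPoly s α * ∏ q ∈ (F.pts s α).erase p, linForm q) := by
    have h := F.prod_linForm_restr (s := s) (α := α)
    rw [← Finset.mul_prod_erase s _ hi, ← Finset.mul_prod_erase (F.pts s α) _ hp,
      linForm_eq_normalized, hip] at h
    apply mul_left_cancel₀ (linForm_ne_zero (F.ne_zero_of_mem_pts hp))
    linear_combination h
  have hkk : (C k⁻¹ * C k : MvPolynomial (Fin 2) K) = 1 := by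
    rw [← C_mul, inv_mul_cancel₀ hk0, C_1]
  refine ⟨C (k⁻¹ * leadingCoord (F.restr (α i))) • _,
    Submodule.smul_mem _ _ (prod_erase_mem_logDer (s := s) hw0), ?_⟩
  rw [map_smul, derApply_const, hw1, C_1, one_mul, smul_eq_mul, map_mul, map_prod]
  simp only [res_linForm, algHom_C, algebraMap_eq, map_mul]
  rw [mul_assoc, key]
  linear_combination (F.multPoly s α * ∏ q ∈ (F.pts s α).erase p, linForm q) * hkk

lemma idealOfVars_pow_le_quotIdeal (hne : ∀ i ∈ s, ∀ c : K, α i ≠ c • a) :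
    idealOfVars (Fin 2) K ^ ((F.pts s α).card - 1) ≤ F.quotIdeal s α := by
  classical
  rcases Nat.eq_zero_or_pos (F.pts s α).card with h | h
  · have hs : s = ∅ := by simpa [pts] using h
    have h1 : (1 : MvPolynomial (Fin 2) K) ∈ F.quotIdeal s α := by
      refine ⟨fun j => C (F.e j) * 1, by simp [hs, mem_logDer], ?_⟩
      rw [derApply_const, F.a_e]
      simp [multPoly, pts, hs]
    rw [(Ideal.eq_top_iff_one _).mpr h1]
    exact le_top
  · exact idealOfVars_pow_le_of_prod_erase_mem _ (F.pts s α) (by omega)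
      (fun p hp q hq => F.det₂_ne_zero_of_mem_pts hp hq) _
      fun p hp => F.prod_pts_erase_mem_quotIdeal hne hp

/-- The restriction to the plane `a = 0` of the value of a derivation at a linear form. -/
noncomputable def resDer (c : Fin 3 → K) :
    (Fin 3 → MvPolynomial (Fin 3) K) →ₗ[K] MvPolynomial (Fin 2) K :=
  F.res.toLinearMap ∘ₗ (derApply c).restrictScalars K

lemma resDer_apply (c : Fin 3 → K) (θ : Fin 3 → MvPolynomial (Fin 3) K) :
    F.resDer c θ = F.res (derApply c θ) := rfl

lemma map_resDer_logDerDeg (hs : IsCentralArr s α) (hne : ∀ i ∈ s, ∀ c : K, α i ≠ c • a) {d : ℕ}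
    (hd : s.card ≤ d) :
    (logDerDeg s α d).map (F.resDer a) = homogeneousMultiples (F.multPoly s α) d := by
  apply le_antisymm
  · rintro _ ⟨θ, ⟨h1, h2⟩, rfl⟩
    exact ⟨F.res_isHomogeneous (derApply_isHomogeneous h2 a),
      F.multPoly_dvd_res_derApply hs hne h1⟩
  · rintro _ ⟨hf, g, rfl⟩
    have hg : g.IsHomogeneous (d - (s.card - (F.pts s α).card)) := by
      refine isHomogeneous_of_mul_left (F.multPoly_isHomogeneous (s := s) (α := α)) F.multPoly_ne_zero ?_
      rwa [Nat.add_sub_cancel' (by omega)]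
    have := F.card_pts_le (s := s) (α := α)
    obtain ⟨θ, hθ, e⟩ := F.idealOfVars_pow_le_quotIdeal hne
      (isHomogeneous_mem_idealOfVars_pow (n := (F.pts s α).card - 1) hg (by omega))
    refine ⟨fun j => homogeneousComponent d (θ j), ⟨homogeneousComponent_mem_logDer hθ d,
      mem_homogDer.mpr fun j => homogeneousComponent_isHomogeneous _ _⟩, ?_⟩
    rw [resDer_apply, derApply_homogeneousComponent, res_homogeneousComponent, e,
      homogeneousComponent_eq_self hf]

lemma mem_ker_resDer {θ : Fin 3 → MvPolynomial (Fin 3) K} :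
    θ ∈ LinearMap.ker (F.resDer a) ↔ linForm a ∣ derApply a θ := by
  rw [LinearMap.mem_ker, resDer_apply, res_eq_zero_iff]

/-- Adding one plane to a central arrangement lowers the dimension of the space of logarithmic
derivations of large degree by an explicit amount. -/
lemma finrank_logDerDeg_insert [DecidableEq ι] {i : ι} (F : PlaneFrame (α i)) (hi : i ∉ s)
    (hs : IsCentralArr (insert i s) α) {d : ℕ} (hd : s.card ≤ d) :
    Module.finrank K (logDerDeg (insert i s) α d) + (d + 1 - (s.card - (F.pts s α).card)) =
      Module.finrank K (logDerDeg s α d) := by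
  have hne : ∀ j ∈ s, ∀ c : K, α j ≠ c • α i := fun j hj =>
    hs.2 i (Finset.mem_insert_self _ _) j (Finset.mem_insert_of_mem hj)
      (ne_of_mem_of_not_mem hj hi).symm
  have h := finrank_map_add_finrank_inf_ker (logDerDeg s α d) (F.resDer (α i))
  rw [F.map_resDer_logDerDeg (hs.mono (Finset.subset_insert _ _)) hne hd,
    finrank_binary_homogeneousMultiples F.multPoly_isHomogeneous F.multPoly_ne_zero] at h
  have e : logDerDeg (insert i s) α d = logDerDeg s α d ⊓ LinearMap.ker (F.resDer (α i)) := by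
    ext θ
    rw [Submodule.mem_inf, mem_ker_resDer, mem_logDerDeg, mem_logDerDeg, mem_logDer, mem_logDer,
      Finset.forall_mem_insert]
    tauto
  rw [e, ← h, add_comm]

end PlaneFrame

end Addition

section Restricted

lemma sum_range_add_one_sub (a D : ℕ) :
    ∑ d ∈ Finset.range (D + 1), (d + 1 - a) = (D + 2 - a).choose 2 := by
  induction D with
  | zero =>
    rcases a with _ | _ | a
    · rfl
    · rfl
    · simp
  | succ D ih =>
    rw [Finset.sum_range_succ, ih]
    by_cases h : a ≤ D + 2
    · obtain ⟨k, hk⟩ := Nat.exists_eq_add_of_le h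
      rw [show D + 1 + 2 - a = k + 1 by omega, show D + 2 - a = k by omega,
        Nat.choose_succ_succ' k 1, Nat.choose_one_right, add_comm]
    · rw [show D + 1 + 2 - a = 0 by omega, show D + 2 - a = 0 by omega,
        Nat.add_zero]

lemma le_sum_of_filtration {f x y z u v : ℕ → ℕ} (hf : ∀ d, f d = x d + (y d + z d))
    (hx : ∀ d, x d ≤ u d) (hy : ∀ d, y d ≤ v d) (hz₀ : z 0 = 0) (hz : ∀ d, z (d + 1) ≤ f d)
    (D : ℕ) : f D ≤ ∑ d ∈ Finset.range (D + 1), u d + ∑ d ∈ Finset.range (D + 1), v d ∧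
      (f D = ∑ d ∈ Finset.range (D + 1), u d + ∑ d ∈ Finset.range (D + 1), v d →
        ∀ d ≤ D, x d = u d ∧ y d = v d) := by
  induction D with
  | zero =>
    have h1 := hf 0
    have h2 := hx 0
    have h3 := hy 0
    simp only [zero_add, Finset.sum_range_one]
    refine ⟨by omega, fun h d hd => ?_⟩
    rw [Nat.le_zero.mp hd]
    omega
  | succ D ih =>
    have h1 := hf (D + 1)
    have h2 := hx (D + 1)
    have h3 := hy (D + 1)
    have h4 := hz D
    rw [Finset.sum_range_succ _ (D + 1), Finset.sum_range_succ _ (D + 1)]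
    refine ⟨by omega, fun h d hd => ?_⟩
    rcases Nat.lt_or_ge d (D + 1) with hlt | hge
    · exact ih.2 (by omega) d (by omega)
    · rw [show d = D + 1 by omega]
      omega

namespace PlaneFrame

variable {ι : Type*} {a : Fin 3 → K} (F : PlaneFrame a)

lemma resDer_eq {θ : Fin 3 → MvPolynomial (Fin 3) K} (h : F.resDer a θ = 0) (c : Fin 3 → K) :
    F.resDer c θ = C (F.restr c 0) * F.resDer F.b₀ θ + C (F.restr c 1) * F.resDer F.b₁ θ := by
  simp only [resDer_apply] at *
  conv_lhs => rw [F.decomp c, derApply_add, derApply_add, derApply_smul, derApply_smul,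
    derApply_smul, map_add, map_add, map_mul, map_mul, map_mul, h, mul_zero, zero_add, algHom_C,
    algHom_C]
  rfl

/-- The value at a derivation of the restriction to the plane `a = 0` of the two-form dual to the
Euler derivation of the plane. -/
noncomputable def wronskian : (Fin 3 → MvPolynomial (Fin 3) K) →ₗ[K] MvPolynomial (Fin 2) K :=
  LinearMap.mulRight K (X 1) ∘ₗ F.resDer F.b₀ - LinearMap.mulRight K (X 0) ∘ₗ F.resDer F.b₁

lemma wronskian_apply (θ : Fin 3 → MvPolynomial (Fin 3) K) :
    F.wronskian θ = F.resDer F.b₀ θ * X 1 - F.resDer F.b₁ θ * X 0 := rfl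

lemma wronskian_isHomogeneous {θ : Fin 3 → MvPolynomial (Fin 3) K} {d : ℕ}
    (hθ : θ ∈ homogDer d) : (F.wronskian θ).IsHomogeneous (d + 1) :=
  ((F.res_isHomogeneous (derApply_isHomogeneous hθ _)).mul (isHomogeneous_X _ _)).sub
    ((F.res_isHomogeneous (derApply_isHomogeneous hθ _)).mul (isHomogeneous_X _ _))

lemma linForm_restr_dvd_wronskian {θ : Fin 3 → MvPolynomial (Fin 3) K} (h : F.resDer a θ = 0)
    {c : Fin 3 → K} (hc : F.restr c ≠ 0) (hθ : linForm c ∣ derApply c θ) :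
    linForm (F.restr c) ∣ F.wronskian θ := by
  obtain ⟨g, hg⟩ := map_dvd F.res hθ
  rw [← resDer_apply, F.resDer_eq h, res_linForm] at hg
  have hl := linForm_fin_two (F.restr c)
  rw [wronskian_apply]
  by_cases h0 : F.restr c 0 = 0
  · have h1 : F.restr c 1 ≠ 0 := fun h1 => hc (by ext j; fin_cases j; exacts [h0, h1])
    have hu : IsUnit (C (F.restr c 1) : MvPolynomial (Fin 2) K) :=
      (isUnit_iff_ne_zero.mpr h1).map C
    rw [← hu.dvd_mul_left]
    refine ⟨F.resDer F.b₀ θ - g * X 0, ?_⟩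
    linear_combination (-F.resDer F.b₀ θ) * hl - X 0 * hg
  · have hu : IsUnit (C (F.restr c 0) : MvPolynomial (Fin 2) K) :=
      (isUnit_iff_ne_zero.mpr h0).map C
    rw [← hu.dvd_mul_left]
    refine ⟨g * X 1 - F.resDer F.b₁ θ, ?_⟩
    linear_combination (F.resDer F.b₁ θ) * hl + X 1 * hg

variable {t : Finset ι} {α : ι → Fin 3 → K}

lemma prod_pts_dvd_wronskian (hne : ∀ j ∈ t, ∀ c : K, α j ≠ c • a)
    {θ : Fin 3 → MvPolynomial (Fin 3) K} (h : F.resDer a θ = 0) (hθ : θ ∈ logDer t α) :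
    ∏ p ∈ F.pts t α, linForm p ∣ F.wronskian θ := by
  refine F.prod_pts_dvd fun p hp => ?_
  obtain ⟨j, hj, rfl⟩ := F.mem_pts.mp hp
  refine dvd_trans ?_ (F.linForm_restr_dvd_wronskian h (F.restr_ne_zero (hne j hj)) (hθ j hj))
  rw [linForm_eq_normalized (F.restr (α j))]
  exact dvd_mul_left _ _

lemma exists_of_wronskian_eq_zero {θ : Fin 3 → MvPolynomial (Fin 3) K}
    (h : F.wronskian θ = 0) : ∃ g, F.resDer F.b₀ θ = X 0 * g ∧ F.resDer F.b₁ θ = X 1 * g := by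
  rw [wronskian_apply, sub_eq_zero] at h
  have h0 : (X 0 : MvPolynomial (Fin 2) K) ∣ F.resDer F.b₀ θ * X 1 := ⟨F.resDer F.b₁ θ, by
    rw [h, mul_comm]⟩
  have h1 : ¬ (X 0 : MvPolynomial (Fin 2) K) ∣ X 1 := by
    rw [X_dvd_X]
    simp
  have hX : Prime (X 0 : MvPolynomial (Fin 2) K) := X_prime
  obtain ⟨g, hg⟩ := (hX.dvd_or_dvd h0).resolve_right h1
  refine ⟨g, hg, ?_⟩
  apply mul_right_cancel₀ (X_ne_zero (R := K) (0 : Fin 2))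
  rw [← h, hg]
  ring

lemma mul_multPoly_dvd_resDer (ht : IsCentralArr t α) (hne : ∀ j ∈ t, ∀ c : K, α j ≠ c • a)
    {θ : Fin 3 → MvPolynomial (Fin 3) K} (h : derApply a θ = 0) (hθ : θ ∈ logDer t α)
    (hw : F.wronskian θ = 0) : X 0 * F.multPoly t α ∣ F.resDer F.b₀ θ := by
  obtain ⟨g, h0, h1⟩ := F.exists_of_wronskian_eq_zero hw
  rw [h0]
  refine mul_dvd_mul_left _ (F.multPoly_dvd fun p hp => ?_)
  obtain ⟨i, hi, hip⟩ := F.mem_pts.mp hp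
  have hi0 := F.restr_ne_zero (hne i hi)
  have hdvd := F.pow_mult_dvd_res ht (p := p) (z := derApply (α i) θ) fun j hj hjp => ?_
  · rw [← resDer_apply, F.resDer_eq (by rw [resDer_apply, h, map_zero]), h0, h1] at hdvd
    have e : C (F.restr (α i) 0) * (X 0 * g) + C (F.restr (α i) 1) * (X 1 * g) =
        linForm (F.restr (α i)) * g := by
      rw [linForm_fin_two]
      ring
    rw [e, linForm_eq_normalized (F.restr (α i)), hip, mul_assoc,
      ← Nat.sub_add_cancel (F.one_le_mult hp), pow_succ'] at hdvd
    have hu : IsUnit (C (leadingCoord (F.restr (α i))) : MvPolynomial (Fin 2) K) :=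
      (isUnit_iff_ne_zero.mpr (leadingCoord_ne_zero hi0)).map C
    rw [hu.dvd_mul_left] at hdvd
    exact (mul_dvd_mul_iff_left (linForm_ne_zero (F.ne_zero_of_mem_pts hp))).mp hdvd
  · obtain ⟨k, l, hkl⟩ := F.exists_eq_smul_add_smul hi0 (hjp.trans hip.symm)
    have hk : k ≠ 0 := by
      rintro rfl
      exact hne j hj l (by simpa using hkl)
    have hu : IsUnit (C k : MvPolynomial (Fin 3) K) := (isUnit_iff_ne_zero.mpr hk).map C
    rw [← hu.dvd_mul_left]
    have e := hθ j hj
    conv_rhs at e => rw [hkl, derApply_add, derApply_smul, derApply_smul, h, mul_zero, add_zero]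
    exact e

lemma resDer_b₁_eq_zero {θ : Fin 3 → MvPolynomial (Fin 3) K} (hw : F.wronskian θ = 0)
    (h : F.resDer F.b₀ θ = 0) : F.resDer F.b₁ θ = 0 := by
  obtain ⟨g, h0, h1⟩ := F.exists_of_wronskian_eq_zero hw
  rw [h] at h0
  rw [h1, (mul_eq_zero.mp h0.symm).resolve_left (X_ne_zero _), mul_zero]

lemma linForm_dvd_of_resDer_eq_zero {θ : Fin 3 → MvPolynomial (Fin 3) K}
    (h : F.resDer a θ = 0) (h0 : F.resDer F.b₀ θ = 0) (h1 : F.resDer F.b₁ θ = 0) (j : Fin 3) :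
    linForm a ∣ θ j := by
  have e := F.resDer_eq h (Pi.single j 1)
  rw [h0, h1, mul_zero, mul_zero, add_zero, resDer_apply, res_eq_zero_iff] at e
  simpa [derApply_apply, Pi.single_apply] using e

end PlaneFrame

variable {ι : Type*} [DecidableEq ι]

/-- The homogeneous logarithmic derivations of degree `d` annihilating the form `α i`. -/
noncomputable def tangentDer (t : Finset ι) (α : ι → Fin 3 → K) (i : ι) (d : ℕ) :
    Submodule K (Fin 3 → MvPolynomial (Fin 3) K) :=
  logDerDeg (insert i t) α d ⊓ LinearMap.ker ((derApply (α i)).restrictScalars K)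

lemma mem_tangentDer {t : Finset ι} {α : ι → Fin 3 → K} {i : ι} {d : ℕ}
    {θ : Fin 3 → MvPolynomial (Fin 3) K} : θ ∈ tangentDer t α i d ↔
      θ ∈ logDer (insert i t) α ∧ θ ∈ homogDer d ∧ derApply (α i) θ = 0 := by
  rw [tangentDer, Submodule.mem_inf, mem_logDerDeg, LinearMap.mem_ker, and_assoc]
  rfl

instance tangentDer_finite (t : Finset ι) (α : ι → Fin 3 → K) (i : ι) (d : ℕ) :
    Module.Finite K (tangentDer t α i d) :=
  Submodule.finiteDimensional_of_le
    (inf_le_left : tangentDer t α i d ≤ logDerDeg (insert i t) α d)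

lemma finrank_logDerDeg_eq_tangentDer {t : Finset ι} {α : ι → Fin 3 → K} {i : ι} (hi : α i ≠ 0)
    (d : ℕ) : Module.finrank K (logDerDeg (insert i t) α d) =
      (d + 1).choose 2 + Module.finrank K (tangentDer t α i d) := by
  rw [← finrank_map_add_finrank_inf_ker (logDerDeg (insert i t) α d)
    ((derApply (α i)).restrictScalars K), tangentDer]
  congr 1
  have hmap : (logDerDeg (insert i t) α d).map ((derApply (α i)).restrictScalars K) =
      homogeneousMultiples (linForm (α i)) d := by
    apply le_antisymm
    · rintro _ ⟨θ, ⟨h1, h2⟩, rfl⟩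
      exact ⟨derApply_isHomogeneous h2 _, h1 i (Finset.mem_insert_self _ _)⟩
    · rintro f ⟨hf, g, rfl⟩
      rcases d with _ | d
      · rw [eq_zero_of_dvd_of_lt (linForm_isHomogeneous (α i)) hf (dvd_mul_right _ _) one_pos]
        exact zero_mem _
      · have hg : g.IsHomogeneous d := by
          refine isHomogeneous_of_mul_left (linForm_isHomogeneous _) (linForm_ne_zero hi) ?_
          rwa [add_comm 1 d]
        refine ⟨g • X, ⟨Submodule.smul_mem _ _ (X_mem_logDer _ _),
          mem_homogDer.mpr fun j => hg.mul (isHomogeneous_X _ _)⟩, ?_⟩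
        rw [LinearMap.restrictScalars_apply, map_smul, derApply_X, smul_eq_mul, mul_comm]
  rw [hmap]
  rcases d with _ | d
  · rw [homogeneousMultiples_eq_bot (linForm_isHomogeneous (α i)) one_pos, finrank_bot]
    rfl
  · rw [add_comm d 1, finrank_homogeneousMultiples (linForm_isHomogeneous _) (linForm_ne_zero hi),
      finrank_ternary_forms]
    congr 1
    omega

variable {t : Finset ι} {α : ι → Fin 3 → K} {i : ι}

lemma logDer_of_linForm_smul (ht : IsCentralArr (insert i t) α)
    {θ : Fin 3 → MvPolynomial (Fin 3) K} (h : linForm (α i) • θ ∈ logDer (insert i t) α)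
    (h0 : derApply (α i) θ = 0) : θ ∈ logDer (insert i t) α := by
  intro j hj
  by_cases hji : j = i
  · rw [hji, h0]
    exact dvd_zero _
  · have hd := h j hj
    rw [map_smul, smul_eq_mul] at hd
    exact (linForm_isRelPrime (ht.1 j hj)
      (ht.2 j hj i (Finset.mem_insert_self _ _) hji)).dvd_of_dvd_mul_left hd

/-- The part of `tangentDer` on which the restriction to the plane vanishes comes from lower
degree. -/
lemma PlaneFrame.exists_of_mem_tangentDer (F : PlaneFrame (α i)) (ht : IsCentralArr (insert i t) α)
    {d : ℕ} {θ : Fin 3 → MvPolynomial (Fin 3) K} (hθ : θ ∈ tangentDer t α i d)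
    (hw : F.wronskian θ = 0) (h0 : F.resDer F.b₀ θ = 0) :
    θ = 0 ∨ ∃ e, d = e + 1 ∧ ∃ η ∈ tangentDer t α i e, θ = linForm (α i) • η := by
  obtain ⟨hlog, hhom, hker⟩ := mem_tangentDer.mp hθ
  have hdvd := F.linForm_dvd_of_resDer_eq_zero (by rw [resDer_apply, hker, map_zero]) h0
    (F.resDer_b₁_eq_zero hw h0)
  rcases d with _ | e
  · left
    ext1 j
    exact eq_zero_of_dvd_of_lt (linForm_isHomogeneous _) (mem_homogDer.mp hhom j) (hdvd j) one_pos
  · right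
    choose η hη using hdvd
    have hθη : θ = linForm (α i) • η := funext hη
    have hne := linForm_ne_zero F.a_ne_zero
    have hker' : derApply (α i) η = 0 := by
      rw [hθη, map_smul, smul_eq_mul] at hker
      exact (mul_eq_zero.mp hker).resolve_left hne
    refine ⟨e, rfl, η, mem_tangentDer.mpr ⟨logDer_of_linForm_smul ht (hθη ▸ hlog) hker',
      mem_homogDer.mpr fun j => ?_, hker'⟩, hθη⟩
    refine isHomogeneous_of_mul_left (linForm_isHomogeneous (α i)) hne ?_
    rw [← hη j, add_comm]
    exact mem_homogDer.mp hhom j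

lemma PlaneFrame.finrank_tangentDer (F : PlaneFrame (α i)) (ht : IsCentralArr (insert i t) α)
    (hi : i ∉ t) {m n : ℕ} (hm : (F.pts t α).card = m + 1) (hn : t.card = m + n) (D : ℕ) :
    Module.finrank K (tangentDer t α i D) ≤ (D + 2 - m).choose 2 + (D + 2 - n).choose 2 ∧
    (Module.finrank K (tangentDer t α i D) = (D + 2 - m).choose 2 + (D + 2 - n).choose 2 →
      m ≤ D → n ≤ D → (∃ φ ∈ tangentDer t α i m, F.wronskian φ ≠ 0) ∧
      ∃ ψ ∈ tangentDer t α i n, F.wronskian ψ = 0 ∧ F.resDer F.b₀ ψ ≠ 0) := by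
  have hne : ∀ j ∈ t, ∀ c : K, α j ≠ c • α i := fun j hj =>
    ht.2 i (Finset.mem_insert_self _ _) j (Finset.mem_insert_of_mem hj)
      (ne_of_mem_of_not_mem hj hi).symm
  have ht' : IsCentralArr t α := ht.mono (Finset.subset_insert _ _)
  have hcard := F.card_pts_le (s := t) (α := α)
  set V : ℕ → Submodule K (Fin 3 → MvPolynomial (Fin 3) K) := fun d =>
    tangentDer t α i d ⊓ LinearMap.ker F.wronskian with hV
  have hVfin : ∀ d, Module.Finite K (V d) := fun d =>
    Submodule.finiteDimensional_of_le (inf_le_left : V d ≤ tangentDer t α i d)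
  have hlog : ∀ {d θ}, θ ∈ tangentDer t α i d → θ ∈ logDer t α := fun h j hj =>
    (mem_tangentDer.mp h).1 j (Finset.mem_insert_of_mem hj)
  have key := le_sum_of_filtration (f := fun d => Module.finrank K (tangentDer t α i d))
    (x := fun d => Module.finrank K ((tangentDer t α i d).map F.wronskian))
    (y := fun d => Module.finrank K ((V d).map (F.resDer F.b₀)))
    (z := fun d => Module.finrank K (V d ⊓ LinearMap.ker (F.resDer F.b₀) : Submodule K _))
    (u := fun d => d + 1 - m) (v := fun d => d + 1 - n)
    (fun d => by
      rw [finrank_map_add_finrank_inf_ker (V d), ← finrank_map_add_finrank_inf_ker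
        (tangentDer t α i d) F.wronskian])
    (fun d => by
      have h := finrank_binary_homogeneousMultiples
        (isHomogeneous_prod_linForm (F.pts t α) fun p => p)
        (Finset.prod_ne_zero_iff.mpr fun p hp => linForm_ne_zero (F.ne_zero_of_mem_pts hp)) (d + 1)
      rw [hm, Nat.add_sub_add_right] at h
      rw [← h]
      refine Submodule.finrank_mono ?_
      rintro _ ⟨θ, hθ, rfl⟩
      exact ⟨F.wronskian_isHomogeneous (mem_tangentDer.mp hθ).2.1, F.prod_pts_dvd_wronskian hne
        (by rw [resDer_apply, (mem_tangentDer.mp hθ).2.2, map_zero]) (hlog hθ)⟩)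
    (fun d => by
      have h := finrank_binary_homogeneousMultiples
        ((isHomogeneous_X K (0 : Fin 2)).mul (F.multPoly_isHomogeneous (s := t) (α := α)))
        (mul_ne_zero (X_ne_zero _) F.multPoly_ne_zero) d
      rw [show 1 + (t.card - (F.pts t α).card) = n by omega] at h
      rw [← h]
      refine Submodule.finrank_mono ?_
      rintro _ ⟨θ, ⟨hθ, hw⟩, rfl⟩
      exact ⟨F.res_isHomogeneous (derApply_isHomogeneous (mem_tangentDer.mp hθ).2.1 _),
        F.mul_multPoly_dvd_resDer ht' hne (mem_tangentDer.mp hθ).2.2 (hlog hθ) hw⟩)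
    (by
      refine Submodule.finrank_eq_zero.mpr ((Submodule.eq_bot_iff _).mpr ?_)
      rintro θ ⟨⟨hθ, hw⟩, h0⟩
      exact (F.exists_of_mem_tangentDer ht hθ hw h0).resolve_right fun ⟨e, he, _⟩ => by omega)
    (fun d => by
      have h : V (d + 1) ⊓ LinearMap.ker (F.resDer F.b₀) ≤ (tangentDer t α i d).map
          ((LinearMap.lsmul (MvPolynomial (Fin 3) K) (Fin 3 → MvPolynomial (Fin 3) K)
            (linForm (α i))).restrictScalars K) := by
        rintro θ ⟨⟨hθ, hw⟩, h0⟩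
        rcases F.exists_of_mem_tangentDer ht hθ hw h0 with rfl | ⟨e, he, η, hη, rfl⟩
        · exact zero_mem _
        · obtain rfl : d = e := by omega
          exact ⟨η, hη, rfl⟩
      exact (Submodule.finrank_mono h).trans (Submodule.finrank_map_le _ _))
    D
  simp only [sum_range_add_one_sub] at key
  refine ⟨key.1, fun h hmD hnD => ⟨?_, ?_⟩⟩
  · have h1 := (key.2 h m hmD).1
    by_contra! hcon
    have : (tangentDer t α i m).map F.wronskian = ⊥ := by
      rw [Submodule.eq_bot_iff]
      rintro _ ⟨θ, hθ, rfl⟩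
      exact hcon θ hθ
    rw [this, finrank_bot] at h1
    omega
  · have h1 := (key.2 h n hnD).2
    by_contra! hcon
    have : (V n).map (F.resDer F.b₀) = ⊥ := by
      rw [Submodule.eq_bot_iff]
      rintro _ ⟨θ, ⟨hθ, hw⟩, rfl⟩
      exact hcon θ hθ hw
    rw [this, finrank_bot] at h1
    omega

end Restricted

section Saito

variable {ι : Type*} {s : Finset ι} {α : ι → Fin 3 → K}

lemma prod_linForm_dvd_det (hs : IsCentralArr s α)
    {M : Matrix (Fin 3) (Fin 3) (MvPolynomial (Fin 3) K)} (hM : ∀ r, M r ∈ logDer s α) :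
    ∏ i ∈ s, linForm (α i) ∣ M.det := by
  refine hs.prod_dvd fun i hi => ?_
  obtain ⟨j, hj⟩ := Function.ne_iff.mp (hs.1 i hi)
  have hu : IsUnit (C (α i j) : MvPolynomial (Fin 3) K) := (isUnit_iff_ne_zero.mpr hj).map C
  rw [← hu.dvd_mul_right]
  have h : M.det * C (α i j) =
      (M.adjugate.mulVec (M.mulVec fun l => (C (α i l) : MvPolynomial (Fin 3) K))) j := by
    rw [Matrix.mulVec_mulVec, Matrix.adjugate_mul, Matrix.smul_mulVec, Matrix.one_mulVec]
    rfl
  rw [h, Matrix.mulVec, dotProduct]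
  refine Finset.dvd_sum fun r _ => Dvd.dvd.mul_left ?_ _
  have e : (M.mulVec fun l => (C (α i l) : MvPolynomial (Fin 3) K)) r = derApply (α i) (M r) := by
    rw [derApply_apply, Matrix.mulVec, dotProduct]
    exact Finset.sum_congr rfl fun l _ => mul_comm _ _
  rw [e]
  exact hM r i hi

/-- Saito's criterion: three homogeneous logarithmic derivations with nonzero determinant whose
degrees add up to the number of planes form a basis. -/
lemma existsUnique_of_det_ne_zero (hs : IsCentralArr s α) {m n : ℕ} (hmn : s.card = m + n + 1)
    {φ ψ : Fin 3 → MvPolynomial (Fin 3) K} (hφ : φ ∈ logDerDeg s α m) (hψ : ψ ∈ logDerDeg s α n)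
    (hdet : (Matrix.of ![X, φ, ψ]).det ≠ 0) {θ : Fin 3 → MvPolynomial (Fin 3) K}
    (hθ : θ ∈ logDer s α) :
    ∃! cfs : MvPolynomial (Fin 3) K × MvPolynomial (Fin 3) K × MvPolynomial (Fin 3) K,
      θ = fun j => cfs.1 * X j + cfs.2.1 * φ j + cfs.2.2 * ψ j := by
  set M : Matrix (Fin 3) (Fin 3) (MvPolynomial (Fin 3) K) := Matrix.of ![X, φ, ψ] with hMdef
  have hM : ∀ r, M r ∈ logDer s α := by
    intro r
    fin_cases r
    exacts [X_mem_logDer s α, hφ.1, hψ.1]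
  have hvec : ∀ c : Fin 3 → MvPolynomial (Fin 3) K,
      Matrix.vecMul c M = fun j => c 0 * X j + c 1 * φ j + c 2 * ψ j := by
    intro c
    ext1 j
    rw [Matrix.vecMul, dotProduct, Fin.sum_univ_three]
    rfl
  have hXh := fun j : Fin 3 => isHomogeneous_X K j
  have hφh := mem_homogDer.mp hφ.2
  have hψh := mem_homogDer.mp hψ.2
  have hterm : ∀ j k l : Fin 3, (X j * φ k * ψ l).IsHomogeneous (m + n + 1) := fun j k l => by
    rw [show m + n + 1 = 1 + m + n by omega]
    exact ((hXh j).mul (hφh k)).mul (hψh l)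
  have hdeg : M.det.IsHomogeneous (m + n + 1) := by
    rw [Matrix.det_fin_three]
    exact ((((((hterm 0 1 2).sub (hterm 0 2 1)).sub (hterm 1 0 2)).add (hterm 1 2 0)).add
      (hterm 2 0 1)).sub (hterm 2 1 0))
  obtain ⟨k, hk⟩ := prod_linForm_dvd_det hs hM
  have hQ0 : ∏ i ∈ s, linForm (α i) ≠ 0 :=
    Finset.prod_ne_zero_iff.mpr fun i hi => linForm_ne_zero (hs.1 i hi)
  have hk0 : k.IsHomogeneous 0 := by
    refine isHomogeneous_of_mul_left (isHomogeneous_prod_linForm s α) hQ0 ?_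
    rwa [← hk, hmn]
  obtain ⟨κ, rfl⟩ : ∃ κ, k = C κ :=
    ⟨_, totalDegree_eq_zero_iff_eq_C.mp (Nat.le_zero.mp hk0.totalDegree_le)⟩
  have hκ : κ ≠ 0 := by
    rintro rfl
    rw [C_0, mul_zero] at hk
    exact hdet hk
  have hκκ : (C κ⁻¹ * C κ : MvPolynomial (Fin 3) K) = 1 := by
    rw [← C_mul, inv_mul_cancel₀ hκ, C_1]
  have hcr : ∀ r, ∏ i ∈ s, linForm (α i) ∣ Matrix.cramer M.transpose θ r := by
    intro r
    rw [Matrix.cramer_transpose_apply]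
    refine prod_linForm_dvd_det hs fun r' => ?_
    by_cases h : r' = r
    · rw [h, Matrix.updateRow_self]
      exact hθ
    · rw [Matrix.updateRow_ne h]
      exact hM r'
  choose q hq using hcr
  have hsol : Matrix.vecMul (fun r => C κ⁻¹ * q r) M = θ := by
    have h := Matrix.mulVec_cramer M.transpose θ
    rw [Matrix.mulVec_transpose, Matrix.det_transpose, hk] at h
    ext1 j
    have hj := congrFun h j
    rw [hvec] at hj ⊢
    simp only [hq, Pi.smul_apply, smul_eq_mul] at hj
    have hj' : q 0 * X j + q 1 * φ j + q 2 * ψ j = C κ * θ j := by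
      apply mul_left_cancel₀ hQ0
      linear_combination hj
    linear_combination C κ⁻¹ * hj' + θ j * hκκ
  refine ⟨(C κ⁻¹ * q 0, C κ⁻¹ * q 1, C κ⁻¹ * q 2), by rw [← hsol, hvec], ?_⟩
  rintro ⟨c₀, c₁, c₂⟩ hc
  have h0 : Matrix.vecMul (![c₀, c₁, c₂] - fun r => C κ⁻¹ * q r) M = 0 := by
    rw [Matrix.sub_vecMul, hsol, hvec, sub_eq_zero, hc]
    rfl
  have h1 := sub_eq_zero.mp (Matrix.eq_zero_of_vecMul_eq_zero hdet h0)
  exact Prod.ext (congrFun h1 0) (Prod.ext (congrFun h1 1) (congrFun h1 2))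

lemma PlaneFrame.det_ne_zero {a : Fin 3 → K} (F : PlaneFrame a)
    {φ ψ : Fin 3 → MvPolynomial (Fin 3) K} (hφ : derApply a φ = 0) (hψ : derApply a ψ = 0)
    (hφw : F.wronskian φ ≠ 0) (hψw : F.wronskian ψ = 0) (hψ0 : F.resDer F.b₀ ψ ≠ 0) :
    (Matrix.of ![X, φ, ψ]).det ≠ 0 := by
  intro hdet
  have h : (Matrix.of ![X, φ, ψ] *
      (Matrix.of ![fun j => C (a j), fun j => C (F.b₀ j), fun j => C (F.b₁ j)]).transpose).det =
      linForm a * (derApply F.b₀ φ * derApply F.b₁ ψ - derApply F.b₁ φ * derApply F.b₀ ψ) := by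
    have e : Matrix.of ![X, φ, ψ] *
        (Matrix.of ![fun j => C (a j), fun j => C (F.b₀ j), fun j => C (F.b₁ j)]).transpose =
        Matrix.of ![![derApply a X, derApply F.b₀ X, derApply F.b₁ X],
          ![derApply a φ, derApply F.b₀ φ, derApply F.b₁ φ],
          ![derApply a ψ, derApply F.b₀ ψ, derApply F.b₁ ψ]] := by
      ext1 r c
      fin_cases r <;> fin_cases c <;>
        simp [Matrix.mul_apply, derApply_apply, Fin.sum_univ_three, mul_comm]
    rw [e, Matrix.det_fin_three]
    simp [hφ, hψ, derApply_X]
    ring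
  rw [Matrix.det_mul, hdet, zero_mul] at h
  have h1 := congrArg F.res ((mul_eq_zero.mp h.symm).resolve_left (linForm_ne_zero F.a_ne_zero))
  obtain ⟨g, h2, h3⟩ := F.exists_of_wronskian_eq_zero hψw
  have hg : g ≠ 0 := by
    rintro rfl
    exact hψ0 (by rw [h2, mul_zero])
  rw [map_sub, map_mul, map_mul, map_zero] at h1
  simp only [← resDer_apply] at h1
  rw [h2, h3] at h1
  refine hφw ((mul_eq_zero.mp (?_ : g * _ = 0)).resolve_left hg)
  rw [wronskian_apply]
  linear_combination h1

variable [DecidableEq ι] {t : Finset ι} {i : ι}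

/-- If the dimensions of the spaces of logarithmic derivations are those of a free arrangement
with exponents `m, n`, where `m + 1` is the number of points cut out on the plane `α i = 0`, then
the arrangement is free with these exponents. -/
lemma PlaneFrame.free_of_finrank_eq (F : PlaneFrame (α i)) (ht : IsCentralArr (insert i t) α)
    (hi : i ∉ t) {m n D : ℕ} (hm : (F.pts t α).card = m + 1) (hn : t.card = m + n)
    (hmD : m ≤ D) (hnD : n ≤ D)
    (hD : Module.finrank K (logDerDeg (insert i t) α D) =
      (D + 1).choose 2 + ((D + 2 - m).choose 2 + (D + 2 - n).choose 2)) :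
    ∃ φ ∈ logDerDeg (insert i t) α m, ∃ ψ ∈ logDerDeg (insert i t) α n,
      ∀ θ ∈ logDer (insert i t) α,
      ∃! cfs : MvPolynomial (Fin 3) K × MvPolynomial (Fin 3) K × MvPolynomial (Fin 3) K,
        θ = fun j => cfs.1 * X j + cfs.2.1 * φ j + cfs.2.2 * ψ j := by
  rw [finrank_logDerDeg_eq_tangentDer (ht.1 i (Finset.mem_insert_self _ _)),
    Nat.add_left_cancel_iff] at hD
  obtain ⟨⟨φ, hφ, hφw⟩, ψ, hψ, hψw, hψ0⟩ := (F.finrank_tangentDer ht hi hm hn D).2 hD hmD hnD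
  refine ⟨φ, hφ.1, ψ, hψ.1, fun θ hθ => existsUnique_of_det_ne_zero ht ?_ hφ.1 hψ.1
    (F.det_ne_zero (mem_tangentDer.mp hφ).2.2 (mem_tangentDer.mp hψ).2.2 hφw hψw hψ0) hθ⟩
  rw [Finset.card_insert_of_notMem hi, hn]

end Saito

section Affine

/-- The point of the plane `z = 1` in `K³` corresponding to a point of `K²`. -/
def lift₃ (p : K × K) : Fin 3 → K := ![p.1, p.2, 1]

lemma dotProduct_lift₃ (c : Fin 3 → K) (p : K × K) :
    c ⬝ᵥ lift₃ p = c 0 * p.1 + c 1 * p.2 + c 2 := by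
  simp [lift₃, dotProduct, Fin.sum_univ_three]

lemma exists_lineCoef {L : Set (K × K)} (h : IsAffineLine L) :
    ∃ c : Fin 3 → K, (c 0 ≠ 0 ∨ c 1 ≠ 0) ∧ ∀ p, p ∈ L ↔ c ⬝ᵥ lift₃ p = 0 := by
  obtain ⟨a, b, c, hab, rfl⟩ := h
  refine ⟨![a, b, c], ?_, fun p => by rw [dotProduct_lift₃]; rfl⟩
  by_contra! h0
  exact hab (Prod.ext h0.1 h0.2)

open Classical in
/-- The coefficients of an equation of an affine line. -/
noncomputable def lineCoef (L : Set (K × K)) : Fin 3 → K :=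
  if h : IsAffineLine L then (exists_lineCoef h).choose else 0

lemma lineCoef_ne_zero {L : Set (K × K)} (h : IsAffineLine L) :
    lineCoef L 0 ≠ 0 ∨ lineCoef L 1 ≠ 0 := by
  rw [lineCoef, dif_pos h]
  exact (exists_lineCoef h).choose_spec.1

lemma mem_iff_lineCoef {L : Set (K × K)} (h : IsAffineLine L) (p : K × K) :
    p ∈ L ↔ lineCoef L ⬝ᵥ lift₃ p = 0 := by
  rw [lineCoef, dif_pos h]
  exact (exists_lineCoef h).choose_spec.2 p

/-- The defining forms of the cone of an arrangement; `none` is the plane `z = 0`. -/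
noncomputable def coneForm : Option (Set (K × K)) → Fin 3 → K
  | none => ![0, 0, 1]
  | some L => lineCoef L

lemma eq_of_lineCoef_eq_smul {L M : Set (K × K)} (hL : IsAffineLine L) (hM : IsAffineLine M)
    {c : K} (h : lineCoef M = c • lineCoef L) : M = L := by
  have hc : c ≠ 0 := by
    rintro rfl
    rw [zero_smul] at h
    rcases lineCoef_ne_zero hM with h0 | h0 <;> exact h0 (by rw [h]; rfl)
  ext p
  rw [mem_iff_lineCoef hM, mem_iff_lineCoef hL, h, smul_dotProduct, smul_eq_mul, mul_eq_zero,
    or_iff_right hc]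

lemma isCentralArr_coneForm {A : Finset (Set (K × K))} (hA : IsLineArr A) :
    IsCentralArr (Finset.insertNone A) coneForm := by
  constructor
  · rintro (_ | L) hL h
    · exact one_ne_zero (congrFun h 2)
    · have h' : lineCoef L = 0 := h
      rcases lineCoef_ne_zero (hA L (Finset.some_mem_insertNone.mp hL)) with h0 | h0 <;>
        exact h0 (by rw [h']; rfl)
  · rintro (_ | L) hL (_ | M) hM hne c h
    · exact hne rfl
    · have h' : lineCoef M = c • ![0, 0, 1] := h
      rcases lineCoef_ne_zero (hA M (Finset.some_mem_insertNone.mp hM)) with h0 | h0 <;>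
        exact h0 (by rw [h']; simp)
    · have h' : ![0, 0, 1] = c • lineCoef L := h
      have hc : c ≠ 0 := by
        rintro rfl
        simpa using congrFun h' 2
      have e0 := congrFun h' 0
      have e1 := congrFun h' 1
      simp only [Pi.smul_apply, smul_eq_mul, Matrix.cons_val_zero, Matrix.cons_val_one,
        zero_eq_mul, hc, false_or] at e0 e1
      rcases lineCoef_ne_zero (hA L (Finset.some_mem_insertNone.mp hL)) with h0 | h0
      exacts [h0 e0, h0 e1]
    · exact hne (congrArg some (eq_of_lineCoef_eq_smul (hA L (Finset.some_mem_insertNone.mp hL))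
        (hA M (Finset.some_mem_insertNone.mp hM)) h).symm)

lemma exists_eq_smul_lineCoef {L : Set (K × K)} (hL : IsAffineLine L) {a b c : K}
    (h : L = {p : K × K | a * p.1 + b * p.2 + c = 0}) : ∃ k : K, ![a, b, c] = k • lineCoef L := by
  have hmem := mem_iff_lineCoef hL
  have hne := lineCoef_ne_zero hL
  generalize lineCoef L = l at *
  obtain ⟨p, hp⟩ : ∃ p : K × K, l 0 * p.1 + l 1 * p.2 + l 2 = 0 := by
    rcases hne with h0 | h0
    · exact ⟨(-(l 2) / l 0, 0), by field_simp; ring⟩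
    · exact ⟨(0, -(l 2) / l 1), by field_simp; ring⟩
  have h1 : a * p.1 + b * p.2 + c = 0 := by
    have : p ∈ L := (hmem p).mpr (by rw [dotProduct_lift₃, hp])
    rwa [h] at this
  have h2 : a * (p.1 - l 1) + b * (p.2 + l 0) + c = 0 := by
    have : (p.1 - l 1, p.2 + l 0) ∈ L := (hmem _).mpr (by
      rw [dotProduct_lift₃]
      linear_combination hp)
    rwa [h] at this
  have h3 : a * l 1 = b * l 0 := by linear_combination h1 - h2
  rcases hne with h0 | h0
  · refine ⟨a / l 0, ?_⟩
    ext j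
    fin_cases j
    · simp [h0]
    · simp only [Fin.mk_one, Matrix.cons_val_one, Pi.smul_apply, smul_eq_mul, Matrix.cons_val_zero]
      field_simp
      exact h3.symm
    · simp only [Fin.reduceFinMk, Matrix.cons_val, Pi.smul_apply, smul_eq_mul]
      field_simp
      linear_combination l 0 * h1 - a * hp + p.2 * h3
  · refine ⟨b / l 1, ?_⟩
    ext j
    fin_cases j
    · simp only [Fin.zero_eta, Matrix.cons_val_zero, Pi.smul_apply, smul_eq_mul]
      field_simp
      exact h3
    · simp [h0]
    · simp only [Fin.reduceFinMk, Matrix.cons_val, Pi.smul_apply, smul_eq_mul]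
      field_simp
      linear_combination l 1 * h1 - b * hp - p.1 * h3

lemma lin3_eq_linForm (a b c : K) : lin3 a b c = linForm ![a, b, c] := by
  simp [lin3, linForm, Fin.sum_univ_three]

lemma applyDer3_lin3 (θ : Fin 3 → MvPolynomial (Fin 3) K) (a b c : K) :
    applyDer3 θ (lin3 a b c) = derApply ![a, b, c] θ := by
  simp [applyDer3, lin3, derApply_apply, Fin.sum_univ_three, pderiv_X, Pi.single_apply, mul_comm]

lemma inDCone_iff {A : Finset (Set (K × K))} (hA : IsLineArr A)
    {θ : Fin 3 → MvPolynomial (Fin 3) K} :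
    InDCone A θ ↔ θ ∈ logDer (Finset.insertNone A) coneForm := by
  have hX : (X 2 : MvPolynomial (Fin 3) K) = lin3 0 0 1 := by simp [lin3]
  have hdvd : ∀ a b c : K, (∃ g, applyDer3 θ (lin3 a b c) = g * lin3 a b c) ↔
      linForm ![a, b, c] ∣ derApply ![a, b, c] θ := fun a b c => by
    rw [applyDer3_lin3, lin3_eq_linForm, dvd_iff_exists_eq_mul_left]
  rw [mem_logDer, Finset.forall_mem_insertNone, InDCone, and_comm, hX, hdvd]
  refine and_congr Iff.rfl ⟨fun h L hL => ?_, fun h L hL a b c hab e => ?_⟩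
  · have e : coneForm (some L) = ![lineCoef L 0, lineCoef L 1, lineCoef L 2] := by
      ext j
      fin_cases j <;> rfl
    rw [e, ← hdvd]
    refine h L hL _ _ _ (fun h0 => ?_) ?_
    · rw [Prod.mk.injEq] at h0
      rcases lineCoef_ne_zero (hA L hL) with h1 | h1
      exacts [h1 h0.1, h1 h0.2]
    · ext p
      rw [mem_iff_lineCoef (hA L hL), dotProduct_lift₃]
      rfl
  · obtain ⟨k, hk⟩ := exists_eq_smul_lineCoef (hA L hL) e
    rw [hdvd, hk, linForm_smul, derApply_smul]
    exact mul_dvd_mul_left _ (h L hL)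

/-- The standard frame of the plane `z = 0`. -/
noncomputable def frameAtInfinity : PlaneFrame (coneForm (K := K) none) where
  e := ![0, 0, 1]
  u := ![1, 0, 0]
  v := ![0, 1, 0]
  b₀ := ![1, 0, 0]
  b₁ := ![0, 1, 0]
  a_e := by simp [coneForm, dotProduct, Fin.sum_univ_three]
  a_u := by simp [coneForm, dotProduct, Fin.sum_univ_three]
  a_v := by simp [coneForm, dotProduct, Fin.sum_univ_three]
  b₀_u := by simp [dotProduct, Fin.sum_univ_three]
  b₀_v := by simp [dotProduct, Fin.sum_univ_three]
  b₁_u := by simp [dotProduct, Fin.sum_univ_three]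
  b₁_v := by simp [dotProduct, Fin.sum_univ_three]
  decomp c := by
    ext j
    fin_cases j <;> simp [coneForm, dotProduct, Fin.sum_univ_three]

lemma exists_frame {a : Fin 3 → K} (ha : a 0 ≠ 0 ∨ a 1 ≠ 0) :
    ∃ F : PlaneFrame a, F.u ≠ 0 ∧ F.u 2 = 0 ∧ F.v 2 = 1 := by
  rcases ha with h | h
  · refine ⟨⟨![1 / a 0, 0, 0], ![-(a 1), a 0, 0], ![-(a 2) / a 0, 0, 1], ![0, 1 / a 0, 0],
      ![0, 0, 1], ?_, ?_, ?_, ?_, ?_, ?_, ?_, fun c => ?_⟩, ?_, ?_, ?_⟩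
    case refine_8 =>
      ext j
      simp only [dotProduct, Fin.sum_univ_three, Pi.add_apply, Pi.smul_apply, smul_eq_mul]
      fin_cases j <;> simp <;> field_simp <;> ring
    case refine_9 => exact fun h0 => h (congrFun h0 1)
    all_goals simp [dotProduct, Fin.sum_univ_three, h]
    · ring
    · field_simp
      ring
  · refine ⟨⟨![0, 1 / a 1, 0], ![-(a 1), a 0, 0], ![0, -(a 2) / a 1, 1], ![-1 / a 1, 0, 0],
      ![0, 0, 1], ?_, ?_, ?_, ?_, ?_, ?_, ?_, fun c => ?_⟩, ?_, ?_, ?_⟩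
    case refine_8 =>
      ext j
      simp only [dotProduct, Fin.sum_univ_three, Pi.add_apply, Pi.smul_apply, smul_eq_mul]
      fin_cases j <;> simp <;> field_simp <;> ring
    case refine_9 => exact fun h0 => h (neg_eq_zero.mp (congrFun h0 0))
    all_goals simp [dotProduct, Fin.sum_univ_three, h]
    · ring
    · field_simp
      ring

end Affine

section Points

lemma PlaneFrame.exists_lift₃_eq {a : Fin 3 → K} (F : PlaneFrame a) (hu : F.u 2 = 0)
    (hv : F.v 2 = 1) {p : K × K} (hp : a ⬝ᵥ lift₃ p = 0) :
    ∃ τ : K, lift₃ p = F.v + τ • F.u := by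
  have h : ∀ j, lift₃ p j = F.u j * (F.b₀ ⬝ᵥ lift₃ p) + F.v j * (F.b₁ ⬝ᵥ lift₃ p) := fun j => by
    have h := congrArg (· ⬝ᵥ lift₃ p) (F.decomp (Pi.single j 1))
    simpa only [single_one_dotProduct, add_dotProduct, smul_dotProduct, hp, smul_eq_mul, mul_zero,
      zero_add] using h
  have h2 : F.b₁ ⬝ᵥ lift₃ p = 1 := by
    have := h 2
    rw [hu, hv, zero_mul, zero_add, one_mul] at this
    exact this.symm
  refine ⟨F.b₀ ⬝ᵥ lift₃ p, funext fun j => ?_⟩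
  rw [h j, h2, Pi.add_apply, Pi.smul_apply, smul_eq_mul]
  ring

/-- The affine point of the plane `a = 0` at which a linear form restricting to `q` vanishes. -/
def PlaneFrame.affinePoint {a : Fin 3 → K} (F : PlaneFrame a) (q : Fin 2 → K) : K × K :=
  (F.v 0 - q 1 * F.u 0, F.v 1 - q 1 * F.u 1)

lemma PlaneFrame.lift₃_affinePoint {a : Fin 3 → K} (F : PlaneFrame a) (hu : F.u 2 = 0)
    (hv : F.v 2 = 1) (q : Fin 2 → K) : lift₃ (F.affinePoint q) = F.v - q 1 • F.u := by
  ext j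
  fin_cases j <;> simp [lift₃, affinePoint, hu, hv]

lemma normalized_eq_infinity_iff (q : Fin 2 → K) : normalized q = ![0, 1] ↔ q 0 = 0 := by
  unfold normalized
  split_ifs with h
  · simp [h]
  · simp only [h, iff_false]
    exact fun h0 => one_ne_zero (congrFun h0 0)

variable {A : Finset (Set (K × K))} {H : Set (K × K)}

open Classical in
lemma intersectionPoints_eq (hA : IsLineArr A) (hH : IsAffineLine H) (F : PlaneFrame (lineCoef H))
    (hu : F.u 2 = 0) (hv : F.v 2 = 1) :
    {p : K × K | p ∈ H ∧ ∃ L ∈ A, L ≠ H ∧ p ∈ L} =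
      F.affinePoint '' ↑((F.pts (Finset.insertNone (A.erase H)) coneForm).erase ![0, 1]) := by
  have hdot : ∀ (c : Fin 3 → K) (τ : K), c ⬝ᵥ (F.v + τ • F.u) = c ⬝ᵥ F.v + τ * c ⬝ᵥ F.u :=
    fun c τ => by rw [dotProduct_add, dotProduct_smul, smul_eq_mul]
  ext p
  simp only [Set.mem_ofPred_eq, Set.mem_image, Finset.mem_coe, Finset.mem_erase, F.mem_pts]
  constructor
  · rintro ⟨hpH, L, hL, hLH, hpL⟩
    obtain ⟨τ, hτ⟩ := F.exists_lift₃_eq hu hv ((mem_iff_lineCoef hH p).mp hpH)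
    rw [mem_iff_lineCoef (hA L hL), hτ, hdot] at hpL
    have h0 : lineCoef L ⬝ᵥ F.u ≠ 0 := by
      intro h0
      rw [h0, mul_zero, add_zero] at hpL
      refine F.restr_ne_zero (c := lineCoef L)
        (fun k hk => hLH (eq_of_lineCoef_eq_smul hH (hA L hL) hk)) ?_
      rw [PlaneFrame.restr, h0, hpL]
      ext j
      fin_cases j <;> rfl
    refine ⟨normalized (F.restr (lineCoef L)), ⟨?_, some L, ?_, rfl⟩, ?_⟩
    · rw [Ne, normalized_eq_infinity_iff]
      exact h0
    · simp [hL, hLH]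
    · have h1 : normalized (F.restr (lineCoef L)) 1 = -τ := by
        rw [normalized, if_neg (show F.restr (lineCoef L) 0 ≠ 0 from h0)]
        simp only [PlaneFrame.restr, Matrix.cons_val_one, Matrix.cons_val_zero]
        field_simp
        linear_combination hpL
      have e : lift₃ (F.affinePoint (normalized (F.restr (lineCoef L)))) = lift₃ p := by
        rw [F.lift₃_affinePoint hu hv, hτ, h1, neg_smul, sub_neg_eq_add]
      exact Prod.ext (congrFun e 0) (congrFun e 1)
  · rintro ⟨q, ⟨hq, i, hi, rfl⟩, rfl⟩
    rw [Ne, normalized_eq_infinity_iff] at hq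
    rcases i with _ | L
    · refine absurd ?_ hq
      simp [PlaneFrame.restr, coneForm, dotProduct, Fin.sum_univ_three, hu]
    · obtain ⟨hLH, hL⟩ := Finset.mem_erase.mp (Finset.some_mem_insertNone.mp hi)
      have hq' : lineCoef L ⬝ᵥ F.u ≠ 0 := hq
      refine ⟨?_, L, hL, hLH, ?_⟩
      · rw [mem_iff_lineCoef hH, F.lift₃_affinePoint hu hv, dotProduct_sub, dotProduct_smul,
          F.a_v, F.a_u, smul_zero, sub_zero]
      · rw [mem_iff_lineCoef (hA L hL), F.lift₃_affinePoint hu hv, dotProduct_sub,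
          dotProduct_smul, normalized, if_neg hq]
        simp only [PlaneFrame.restr, coneForm, Matrix.cons_val_one, Matrix.cons_val_zero,
          smul_eq_mul]
        field_simp
        ring

lemma finite_intersectionPoints (hA : IsLineArr A) (hH : IsAffineLine H) :
    {p : K × K | p ∈ H ∧ ∃ L ∈ A, L ≠ H ∧ p ∈ L}.Finite := by
  classical
  obtain ⟨F, -, hu, hv⟩ := exists_frame (lineCoef_ne_zero hH)
  rw [intersectionPoints_eq hA hH F hu hv]
  exact (Finset.finite_toSet _).image _

open Classical in
lemma card_pts_insertNone_erase (hA : IsLineArr A) (hH : IsAffineLine H)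
    (F : PlaneFrame (lineCoef H)) (hu0 : F.u ≠ 0) (hu : F.u 2 = 0) (hv : F.v 2 = 1) :
    (F.pts (Finset.insertNone (A.erase H)) coneForm).card = nOn A H + 1 := by
  have hmem : ![0, 1] ∈ F.pts (Finset.insertNone (A.erase H)) coneForm := by
    refine F.mem_pts.mpr ⟨none, Finset.none_mem_insertNone, ?_⟩
    rw [normalized_eq_infinity_iff]
    simp [PlaneFrame.restr, coneForm, dotProduct, Fin.sum_univ_three, hu]
  rw [← Finset.card_erase_add_one hmem, nOn, intersectionPoints_eq hA hH F hu hv,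
    Set.InjOn.ncard_image, Set.ncard_coe_finset]
  intro p hp q hq hpq
  have h0 : ∀ p ∈ (F.pts (Finset.insertNone (A.erase H)) coneForm).erase ![0, 1], p 0 = 1 := by
    intro p hp
    obtain ⟨hp0, hp⟩ := Finset.mem_erase.mp hp
    obtain ⟨i, -, rfl⟩ := F.mem_pts.mp hp
    rw [Ne, normalized_eq_infinity_iff] at hp0
    rw [normalized, if_neg hp0]
    rfl
  have h1 : (p 1 - q 1) • F.u = 0 := by
    have := congrArg lift₃ hpq
    rw [F.lift₃_affinePoint hu hv, F.lift₃_affinePoint hu hv] at this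
    rw [sub_smul]
    exact sub_eq_zero.mpr (sub_right_injective this)
  have h2 := sub_eq_zero.mp ((smul_eq_zero.mp h1).resolve_right hu0)
  ext j
  fin_cases j
  exacts [(h0 p hp).trans (h0 q hq).symm, h2]

lemma nOn_mono {B : Finset (Set (K × K))} (hA : IsLineArr A) (hH : IsAffineLine H) (h : B ⊆ A) :
    nOn B H ≤ nOn A H :=
  Set.ncard_le_ncard (fun _ ⟨hp, L, hL, hLH, hpL⟩ => ⟨hp, L, h hL, hLH, hpL⟩)
    (finite_intersectionPoints hA hH)

lemma IsAffineLine.eq_of_mem_of_mem {L M : Set (K × K)} (hL : IsAffineLine L)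
    (hM : IsAffineLine M) (h : L ≠ M) {p q : K × K} (hpL : p ∈ L) (hpM : p ∈ M) (hqL : q ∈ L)
    (hqM : q ∈ M) : p = q := by
  by_contra hpq
  have key : ∀ N : Set (K × K), IsAffineLine N → p ∈ N → q ∈ N →
      N = {x | (q.2 - p.2) * (x.1 - p.1) = (q.1 - p.1) * (x.2 - p.2)} := by
    rintro N ⟨a, b, c, hab, rfl⟩ hp hq
    simp only [Set.mem_ofPred_eq] at hp hq
    ext x
    simp only [Set.mem_ofPred_eq]
    constructor
    · intro hx
      by_cases ha : a = 0
      · have hb : b ≠ 0 := fun hb => hab (by rw [ha, hb])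
        refine mul_left_cancel₀ hb ?_
        subst ha
        linear_combination (x.1 - p.1) * (hq - hp) - (q.1 - p.1) * (hx - hp)
      · refine mul_left_cancel₀ ha ?_
        linear_combination (q.2 - p.2) * (hx - hp) - (x.2 - p.2) * (hq - hp)
    · intro hx
      by_cases h1 : q.1 - p.1 = 0
      · have h2 : q.2 - p.2 ≠ 0 := fun h2 =>
          hpq (Prod.ext (sub_eq_zero.mp h1).symm (sub_eq_zero.mp h2).symm)
        refine mul_left_cancel₀ h2 ?_
        linear_combination (x.2 - p.2) * (hq - hp) + a * hx + (q.2 - p.2) * hp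
      · refine mul_left_cancel₀ h1 ?_
        linear_combination (x.1 - p.1) * (hq - hp) - b * hx + (q.1 - p.1) * hp
  exact h ((key L hL hpL hqL).trans (key M hM hpM hqM).symm)

end Points

section Betti

lemma b2_empty {K : Type*} : b2 (∅ : Finset (Set (K × K))) = 0 := by
  classical
  rw [b2]
  refine Finset.sum_eq_zero fun B hB => ?_
  simp only [Finset.powerset_empty, Finset.mem_filter, Finset.mem_singleton] at hB
  obtain ⟨rfl, h, -⟩ := hB
  simp at h

open Classical in
lemma sum_nonempty_powerset {α : Type*} {s : Finset α} (hs : s.Nonempty) :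
    ∑ B ∈ s.powerset, (if B.Nonempty then (-1 : ℤ) ^ (B.card + 1) else 0) = 1 := by
  have h := Finset.sum_powerset_neg_one_pow_card_of_nonempty hs
  have h1 : ∀ B ∈ s.powerset, (if B.Nonempty then (-1 : ℤ) ^ (B.card + 1) else 0) =
      (if B = ∅ then 1 else 0) - (-1 : ℤ) ^ B.card := by
    intro B _
    rcases B.eq_empty_or_nonempty with rfl | hB
    · simp
    · rw [if_pos hB, if_neg hB.ne_empty, pow_succ]
      ring
  rw [Finset.sum_congr rfl h1, Finset.sum_sub_distrib, h]
  simp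

open Classical in
lemma b2_insert {A : Finset (Set (K × K))} {H : Set (K × K)} (hA : IsLineArr A)
    (hH : IsAffineLine H) (hHA : H ∉ A) : b2 (insert H A) = b2 A + nOn A H := by
  have hfin := finite_intersectionPoints hA hH
  set P := hfin.toFinset with hP
  have hcard : (nOn A H : ℤ) = ∑ p ∈ P, 1 := by
    rw [nOn, Set.ncard_eq_toFinset_card _ hfin]
    simp [hP]
  rw [b2, b2, Finset.sum_filter, Finset.sum_filter, Finset.sum_powerset_insert hHA, hcard]
  congr 1
  have hterm : ∀ B ∈ A.powerset, (if 2 ≤ (insert H B).card ∧ (⋂ L ∈ insert H B, L).Nonempty then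
      (-1 : ℤ) ^ (insert H B).card else 0) =
      ∑ p ∈ P, if B ⊆ A.filter (p ∈ ·) then
        (if B.Nonempty then (-1 : ℤ) ^ (B.card + 1) else 0) else 0 := by
    intro B hB
    have hBA := Finset.mem_powerset.mp hB
    have hHB : H ∉ B := fun h => hHA (hBA h)
    rw [Finset.card_insert_of_notMem hHB]
    rcases B.eq_empty_or_nonempty with rfl | hne
    · simp
    rw [← Finset.sum_filter, if_pos hne, Finset.sum_const, nsmul_eq_mul]
    have hmem : ∀ p, p ∈ P.filter (fun p => B ⊆ A.filter (p ∈ ·)) ↔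
        p ∈ ⋂ L ∈ insert H B, L := by
      intro p
      simp only [hP, Finset.mem_filter, Set.Finite.mem_toFinset, Set.mem_iInter,
        Finset.mem_insert, forall_eq_or_imp, Set.mem_ofPred_eq]
      constructor
      · rintro ⟨⟨hpH, -⟩, h⟩
        exact ⟨hpH, fun L hL => (Finset.mem_filter.mp (h hL)).2⟩
      · rintro ⟨hpH, h⟩
        obtain ⟨L, hL⟩ := hne
        exact ⟨⟨hpH, L, hBA hL, fun e => hHB (e ▸ hL), h L hL⟩,
          fun M hM => Finset.mem_filter.mpr ⟨hBA hM, h M hM⟩⟩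
    have hpos := hne.card_pos
    by_cases hI : (⋂ L ∈ insert H B, L).Nonempty
    · rw [if_pos ⟨by omega, hI⟩]
      obtain ⟨p, hp⟩ := hI
      have : P.filter (fun p => B ⊆ A.filter (p ∈ ·)) = {p} := by
        refine Finset.eq_singleton_iff_unique_mem.mpr ⟨(hmem p).mpr hp, fun q hq => ?_⟩
        obtain ⟨L, hL⟩ := hne
        have hq' := (hmem q).mp hq
        simp only [Set.mem_iInter, Finset.mem_insert, forall_eq_or_imp] at hp hq'
        exact IsAffineLine.eq_of_mem_of_mem hH (hA L (hBA hL)) (fun e => hHB (e ▸ hL)) hq'.1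
          (hq'.2 L hL) hp.1 (hp.2 L hL)
      rw [this]
      simp
    · rw [if_neg (fun h => hI h.2)]
      have : P.filter (fun p => B ⊆ A.filter (p ∈ ·)) = ∅ :=
        Finset.eq_empty_of_forall_notMem fun p hp => hI ⟨p, (hmem p).mp hp⟩
      rw [this]
      simp
  rw [Finset.sum_congr rfl hterm, Finset.sum_comm]
  refine Finset.sum_congr rfl fun p hp => ?_
  have hsub : A.powerset.filter (· ⊆ A.filter (p ∈ ·)) = (A.filter (p ∈ ·)).powerset := by
    ext B
    simp only [Finset.mem_filter, Finset.mem_powerset]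
    exact ⟨fun h => h.2, fun h => ⟨h.trans (Finset.filter_subset _ _), h⟩⟩
  rw [← Finset.sum_filter, hsub]
  obtain ⟨-, L, hL, -, hpL⟩ := hfin.mem_toFinset.mp hp
  exact sum_nonempty_powerset ⟨L, Finset.mem_filter.mpr ⟨hL, hpL⟩⟩

open Classical in
lemma insertNone_insert {K : Type*} (A : Finset (Set (K × K))) (H : Set (K × K)) :
    Finset.insertNone (insert H A) = insert (some H) (Finset.insertNone A) := by
  ext (_ | L) <;> simp

lemma card_pts_insertNone {A : Finset (Set (K × K))} {H : Set (K × K)} (hA : IsLineArr A)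
    (hH : IsAffineLine H) (hHA : H ∉ A) (F : PlaneFrame (coneForm (some H))) (hu0 : F.u ≠ 0)
    (hu : F.u 2 = 0) (hv : F.v 2 = 1) :
    (F.pts (Finset.insertNone A) coneForm).card = nOn A H + 1 := by
  classical
  have h := card_pts_insertNone_erase hA hH F hu0 hu hv
  rwa [Finset.erase_eq_of_notMem hHA] at h

/-- The dimension of a large graded piece of the module of logarithmic derivations. -/
theorem two_mul_finrank_logDerDeg {A : Finset (Set (K × K))} (hA : IsLineArr A) {d : ℕ}
    (hd : A.card + 1 ≤ d) :
    2 * (Module.finrank K (logDerDeg (Finset.insertNone A) coneForm d) : ℤ) =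
      3 * (d + 2) * (d + 1) - 2 * (d + 1) * (A.card + 1) + A.card * (A.card - 1) - 2 * b2 A := by
  classical
  induction A using Finset.induction_on with
  | empty =>
    have he : Finset.insertNone (∅ : Finset (Set (K × K))) = insert none ∅ := rfl
    have hc := isCentralArr_coneForm hA
    rw [he] at hc ⊢
    have h := frameAtInfinity.finrank_logDerDeg_insert (Finset.notMem_empty _) hc (d := d)
      (by simp)
    have hall : logDerDeg (∅ : Finset (Option (Set (K × K)))) coneForm d = homogDer d := by
      ext θ
      simp [mem_logDerDeg, mem_logDer]
    have h3 : (d + 2).choose 2 * 2 = (d + 2) * (d + 1) := by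
      rw [Nat.choose_two_right, Nat.div_mul_cancel (Nat.even_mul_pred_self _).two_dvd]
      rfl
    rw [hall, finrank_homogDer, Finset.card_empty, Nat.zero_sub, Nat.sub_zero] at h
    rw [b2_empty, Finset.card_empty]
    zify at h h3
    push_cast
    linear_combination 2 * h + 3 * h3
  | insert H A hHA ih =>
    have hA' : IsLineArr A := fun L hL => hA L (Finset.mem_insert_of_mem hL)
    have hH := hA H (Finset.mem_insert_self _ _)
    rw [Finset.card_insert_of_notMem hHA] at hd ⊢
    obtain ⟨F, hu0, hu, hv⟩ := exists_frame (a := coneForm (some H)) (lineCoef_ne_zero hH)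
    have hc := isCentralArr_coneForm hA
    rw [insertNone_insert] at hc ⊢
    have hs : (Finset.insertNone A).card = A.card + 1 := Finset.card_insertNone A
    have h := PlaneFrame.finrank_logDerDeg_insert (α := coneForm) (i := some H) F (by simpa) hc
      (d := d) (by omega)
    have hle := F.card_pts_le (s := Finset.insertNone A) (α := coneForm)
    have ih' := ih hA' (by omega)
    rw [card_pts_insertNone hA' hH hHA F hu0 hu hv, hs] at h hle
    rw [b2_insert hA' hH hHA]
    have h' : (Module.finrank K (logDerDeg (insert (some H) (Finset.insertNone A)) coneForm d) : ℤ)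
        + (d + 1 - (A.card - nOn A H)) =
        Module.finrank K (logDerDeg (Finset.insertNone A) coneForm d) := by
      omega
    push_cast
    linear_combination ih' + 2 * h'

end Betti

section LineInequality

lemma two_mul_choose_two (k : ℕ) : 2 * (k.choose 2 : ℤ) = k * (k - 1) := by
  induction k with
  | zero => simp
  | succ k ih =>
    rw [Nat.choose_succ_succ' k 1, Nat.choose_one_right]
    push_cast
    linear_combination ih

variable {A : Finset (Set (K × K))} {H : Set (K × K)}

theorem nOn_mul_le_b2 (hA : IsLineArr A) (hH : H ∈ A) :
    nOn A H ≤ A.card ∧ (nOn A H : ℤ) * (A.card - nOn A H) ≤ b2 A ∧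
      ((nOn A H : ℤ) * (A.card - nOn A H) = b2 A → IsFreeExp A (nOn A H) (A.card - nOn A H)) := by
  classical
  obtain ⟨F, hu0, hu, hv⟩ := exists_frame (a := coneForm (some H)) (lineCoef_ne_zero (hA H hH))
  have hm : (F.pts (Finset.insertNone (A.erase H)) coneForm).card = nOn A H + 1 :=
    card_pts_insertNone_erase hA (hA H hH) F hu0 hu hv
  have hcard : (Finset.insertNone (A.erase H)).card = A.card := by
    rw [Finset.card_insertNone, Finset.card_erase_add_one hH]
  have hle : nOn A H ≤ A.card := by
    have h := F.card_pts_le (s := Finset.insertNone (A.erase H)) (α := coneForm)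
    omega
  have hins : insert (some H) (Finset.insertNone (A.erase H)) = Finset.insertNone A := by
    rw [← insertNone_insert, Finset.insert_erase hH]
  have hi : some H ∉ Finset.insertNone (A.erase H) := by simp
  have hc := isCentralArr_coneForm hA
  rw [← hins] at hc
  have hn : (Finset.insertNone (A.erase H)).card = nOn A H + (A.card - nOn A H) := by omega
  set D := A.card + 1 with hD
  have hfin := F.finrank_tangentDer hc hi hm hn D
  have hlog := finrank_logDerDeg_eq_tangentDer (t := Finset.insertNone (A.erase H))
    F.a_ne_zero D
  have hhilb := two_mul_finrank_logDerDeg hA (d := D) le_rfl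
  have hfree := F.free_of_finrank_eq hc hi hm hn (D := D) (by omega) (by omega)
  rw [hins] at hlog hfree
  have e1 := two_mul_choose_two (D + 1)
  have e2 := two_mul_choose_two (D + 2 - nOn A H)
  have e3 := two_mul_choose_two (D + 2 - (A.card - nOn A H))
  rw [Nat.cast_sub (by omega)] at e2 e3
  rw [Nat.cast_sub hle] at e3
  have hDz : (D : ℤ) = A.card + 1 := by simp [hD]
  push_cast at e1 e2 e3
  have hpoly : 2 * (Module.finrank K (logDerDeg (Finset.insertNone A) coneForm D) : ℤ) =
      2 * ((D + 1).choose 2 + ((D + 2 - nOn A H).choose 2 +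
        (D + 2 - (A.card - nOn A H)).choose 2) : ℕ) +
        2 * (nOn A H * (A.card - nOn A H) - b2 A) := by
    push_cast
    linear_combination hhilb - e1 - e2 - e3
  refine ⟨hle, ?_, fun heq => ?_⟩
  · have := hfin.1
    omega
  · obtain ⟨φ, hφ, ψ, hψ, h⟩ := hfree (by omega)
    exact ⟨φ, ψ, (inDCone_iff hA).mpr (mem_logDerDeg.mp hφ).1,
      (inDCone_iff hA).mpr (mem_logDerDeg.mp hψ).1, mem_homogDer.mp (mem_logDerDeg.mp hφ).2,
      mem_homogDer.mp (mem_logDerDeg.mp hψ).2, fun θ hθ => h θ ((inDCone_iff hA).mp hθ)⟩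

end LineInequality

section FreeHilbert

variable {ι : Type*} {s : Finset ι} {α : ι → Fin 3 → K}

/-- The combination of the Euler derivation, `φ` and `ψ` with given coefficients. -/
noncomputable def combination (φ ψ : Fin 3 → MvPolynomial (Fin 3) K) :
    (MvPolynomial (Fin 3) K × MvPolynomial (Fin 3) K × MvPolynomial (Fin 3) K) →ₗ[
      MvPolynomial (Fin 3) K] (Fin 3 → MvPolynomial (Fin 3) K) :=
  (LinearMap.toSpanSingleton _ _ X).coprod
    ((LinearMap.toSpanSingleton _ _ φ).coprod (LinearMap.toSpanSingleton _ _ ψ))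

lemma combination_apply (φ ψ : Fin 3 → MvPolynomial (Fin 3) K)
    (c : MvPolynomial (Fin 3) K × MvPolynomial (Fin 3) K × MvPolynomial (Fin 3) K) :
    combination φ ψ c = fun j => c.1 * X j + c.2.1 * φ j + c.2.2 * ψ j := by
  ext1 j
  simp [combination, add_assoc]

lemma combination_mem_logDer {φ ψ : Fin 3 → MvPolynomial (Fin 3) K} (hφ : φ ∈ logDer s α)
    (hψ : ψ ∈ logDer s α)
    (c : MvPolynomial (Fin 3) K × MvPolynomial (Fin 3) K × MvPolynomial (Fin 3) K) :
    combination φ ψ c ∈ logDer s α :=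
  add_mem (Submodule.smul_mem _ _ (X_mem_logDer s α))
    (add_mem (Submodule.smul_mem _ _ hφ) (Submodule.smul_mem _ _ hψ))

lemma finrank_logDerDeg_of_free {m n e : ℕ} {φ ψ : Fin 3 → MvPolynomial (Fin 3) K}
    (hφ : φ ∈ logDerDeg s α m) (hψ : ψ ∈ logDerDeg s α n)
    (h : ∀ θ ∈ logDer s α, ∃! c, θ = combination φ ψ c) (hm : m ≤ e + 1) (hn : n ≤ e + 1) :
    Module.finrank K (logDerDeg s α (e + 1)) =
      (e + 2).choose 2 + ((e + 1 - m + 2).choose 2 + (e + 1 - n + 2).choose 2) := by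
  obtain ⟨hφl, hφh⟩ := mem_logDerDeg.mp hφ
  obtain ⟨hψl, hψh⟩ := mem_logDerDeg.mp hψ
  set Φ : (homogeneousSubmodule (Fin 3) K e × homogeneousSubmodule (Fin 3) K (e + 1 - m) ×
      homogeneousSubmodule (Fin 3) K (e + 1 - n)) →ₗ[K] (Fin 3 → MvPolynomial (Fin 3) K) :=
    ((combination φ ψ).restrictScalars K) ∘ₗ ((homogeneousSubmodule (Fin 3) K e).subtype.prodMap
      ((homogeneousSubmodule (Fin 3) K (e + 1 - m)).subtype.prodMap
        (homogeneousSubmodule (Fin 3) K (e + 1 - n)).subtype)) with hΦ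
  have hval : ∀ c, Φ c = combination φ ψ (c.1.1, c.2.1.1, c.2.2.1) := fun c => rfl
  have hinj : Function.Injective Φ := by
    intro c c' hcc
    have := (h _ (combination_mem_logDer hφl hψl _)).unique (hval c)
      ((hval c).symm.trans (hcc.trans (hval c')))
    rw [Prod.mk.injEq, Prod.mk.injEq] at this
    exact Prod.ext (Subtype.ext this.1) (Prod.ext (Subtype.ext this.2.1) (Subtype.ext this.2.2))
  have hrange : LinearMap.range Φ = logDerDeg s α (e + 1) := by
    ext θ
    rw [LinearMap.mem_range, mem_logDerDeg]
    constructor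
    · rintro ⟨⟨f, g, k⟩, rfl⟩
      refine ⟨by rw [hval]; exact combination_mem_logDer hφl hψl _, mem_homogDer.mpr fun j => ?_⟩
      rw [hval, combination_apply]
      refine ((f.2.mul (isHomogeneous_X _ _)).add ?_).add ?_
      · have := g.2.mul (mem_homogDer.mp hφh j)
        rwa [Nat.sub_add_cancel hm] at this
      · have := k.2.mul (mem_homogDer.mp hψh j)
        rwa [Nat.sub_add_cancel hn] at this
    · rintro ⟨hlog, hhom⟩
      obtain ⟨⟨f, g, k⟩, rfl, -⟩ := h θ hlog
      refine ⟨⟨⟨_, homogeneousComponent_mem e f⟩, ⟨_, homogeneousComponent_mem (e + 1 - m) g⟩,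
        ⟨_, homogeneousComponent_mem (e + 1 - n) k⟩⟩, ?_⟩
      rw [hval]
      ext1 j
      have hj := homogeneousComponent_eq_self (mem_homogDer.mp hhom j)
      rw [← hj, combination_apply, combination_apply]
      simp only [map_add]
      have e1 := homogeneousComponent_homogeneous_mul (isHomogeneous_X K j) f e
      have e2 := homogeneousComponent_homogeneous_mul (mem_homogDer.mp hφh j) g (e + 1 - m)
      have e3 := homogeneousComponent_homogeneous_mul (mem_homogDer.mp hψh j) k (e + 1 - n)
      rw [Nat.add_sub_cancel' hm] at e2
      rw [Nat.add_sub_cancel' hn] at e3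
      rw [mul_comm f, mul_comm g, mul_comm k, add_comm e 1, e1, add_comm 1 e, e2, e3]
      ring
  rw [← hrange, LinearMap.finrank_range_of_inj hinj, Module.finrank_prod, Module.finrank_prod,
    finrank_ternary_forms, finrank_ternary_forms, finrank_ternary_forms]

theorem IsFreeExp.exponents {A : Finset (Set (K × K))} (hA : IsLineArr A) {m n : ℕ}
    (h : IsFreeExp A m n) : m + n = A.card ∧ (m * n : ℤ) = b2 A := by
  obtain ⟨φ, ψ, hφ, hψ, hφh, hψh, h⟩ := h
  have key : ∀ e, m + n + A.card ≤ e →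
      ((e : ℤ) + 2) * (e + 1) + (e + 3 - m) * (e + 2 - m) + (e + 3 - n) * (e + 2 - n) =
      3 * (e + 3) * (e + 2) - 2 * (e + 2) * (A.card + 1) + A.card * (A.card - 1) - 2 * b2 A := by
    intro e he
    have h1 := finrank_logDerDeg_of_free (e := e)
      (mem_logDerDeg.mpr ⟨(inDCone_iff hA).mp hφ, mem_homogDer.mpr hφh⟩)
      (mem_logDerDeg.mpr ⟨(inDCone_iff hA).mp hψ, mem_homogDer.mpr hψh⟩)
      (fun θ hθ => by simpa only [combination_apply] using h θ ((inDCone_iff hA).mpr hθ))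
      (by omega) (by omega)
    have h2 := two_mul_finrank_logDerDeg hA (d := e + 1) (by omega)
    have e1 := two_mul_choose_two (e + 2)
    have e2 := two_mul_choose_two (e + 1 - m + 2)
    have e3 := two_mul_choose_two (e + 1 - n + 2)
    rw [h1] at h2
    push_cast [Nat.cast_sub (show m ≤ e + 1 by omega)] at e2
    push_cast [Nat.cast_sub (show n ≤ e + 1 by omega)] at e3
    push_cast at h2 e1
    linear_combination h2 - e1 - e2 - e3
  have k1 := key _ le_rfl
  have k2 := key (m + n + A.card + 1) (by omega)
  generalize m + n + A.card = e at k1 k2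
  push_cast at k1 k2
  have hsum : (m : ℤ) + n = A.card := by
    have : 2 * ((m : ℤ) + n - A.card) = 0 := by linear_combination k1 - k2
    omega
  refine ⟨by omega, ?_⟩
  rw [← hsum] at k1
  have : 2 * ((m * n : ℤ) - b2 A) = 0 := by linear_combination -k1
  omega

end FreeHilbert

section ExponentBound

lemma PlaneFrame.wronskian_smul {a : Fin 3 → K} (F : PlaneFrame a) (f : MvPolynomial (Fin 3) K)
    (θ : Fin 3 → MvPolynomial (Fin 3) K) : F.wronskian (f • θ) = F.res f * F.wronskian θ := by
  simp only [wronskian_apply, resDer_apply, map_smul, smul_eq_mul, map_mul]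
  ring

lemma PlaneFrame.wronskian_X {a : Fin 3 → K} (F : PlaneFrame a) : F.wronskian X = 0 := by
  rw [wronskian_apply, resDer_apply, resDer_apply, derApply_X, derApply_X, res_b₀, res_b₁, mul_comm,
    sub_self]

variable {ι : Type*} [DecidableEq ι] {t : Finset ι} {α : ι → Fin 3 → K} {i : ι}

lemma PlaneFrame.wronskian_eq_zero_of_lt (F : PlaneFrame (α i)) (ht : IsCentralArr (insert i t) α)
    (hi : i ∉ t) {d : ℕ} (hd : d + 1 < (F.pts t α).card) {θ : Fin 3 → MvPolynomial (Fin 3) K}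
    (hθ : θ ∈ logDerDeg (insert i t) α d) : F.wronskian θ = 0 := by
  obtain ⟨hlog, hhom⟩ := mem_logDerDeg.mp hθ
  refine eq_zero_of_dvd_of_lt (isHomogeneous_prod_linForm (F.pts t α) fun p => p)
    (F.wronskian_isHomogeneous hhom) (F.prod_pts_dvd_wronskian (fun j hj => ?_) ?_ fun j hj => ?_)
    hd
  · exact ht.2 i (Finset.mem_insert_self _ _) j (Finset.mem_insert_of_mem hj)
      (ne_of_mem_of_not_mem hj hi).symm
  · exact (F.res_eq_zero_iff _).mpr (hlog i (Finset.mem_insert_self _ _))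
  · exact hlog j (Finset.mem_insert_of_mem hj)

lemma PlaneFrame.exists_wronskian_ne_zero (F : PlaneFrame (α i))
    (ht : IsCentralArr (insert i t) α) (hi : i ∉ t) :
    ∃ θ ∈ logDer (insert i t) α, F.wronskian θ ≠ 0 := by
  refine ⟨_, prod_erase_mem_logDer F.a_u, ?_⟩
  rw [Finset.erase_insert hi, wronskian_apply, resDer_apply, resDer_apply, derApply_const,
    derApply_const, F.b₀_u, F.b₁_u, C_1, C_0, one_mul, zero_mul, map_zero, zero_mul, sub_zero,
    map_prod]
  refine mul_ne_zero (Finset.prod_ne_zero_iff.mpr fun j hj => ?_) (X_ne_zero _)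
  rw [res_linForm]
  exact linForm_ne_zero (F.restr_ne_zero (ht.2 i (Finset.mem_insert_self _ _) j
    (Finset.mem_insert_of_mem hj) (ne_of_mem_of_not_mem hj hi).symm))

theorem IsFreeExp.nOn_le_max {A : Finset (Set (K × K))} {H : Set (K × K)} (hA : IsLineArr A)
    (hH : H ∈ A) {m n : ℕ} (h : IsFreeExp A m n) : nOn A H ≤ max m n := by
  classical
  obtain ⟨φ, ψ, hφ, hψ, hφh, hψh, h⟩ := h
  obtain ⟨F, hu0, hu, hv⟩ := exists_frame (a := coneForm (some H)) (lineCoef_ne_zero (hA H hH))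
  have hcard : (F.pts (Finset.insertNone (A.erase H)) coneForm).card = nOn A H + 1 :=
    card_pts_insertNone_erase hA (hA H hH) F hu0 hu hv
  have hins : insert (some H) (Finset.insertNone (A.erase H)) = Finset.insertNone A := by
    rw [← insertNone_insert, Finset.insert_erase hH]
  have hi : some H ∉ Finset.insertNone (A.erase H) := by simp
  have hc := isCentralArr_coneForm hA
  rw [← hins] at hc
  by_contra! hlt
  have hmem : ∀ {θ : Fin 3 → MvPolynomial (Fin 3) K}, InDCone A θ ↔
      θ ∈ logDer (insert (some H) (Finset.insertNone (A.erase H))) coneForm := by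
    rw [hins]
    exact inDCone_iff hA
  have hφ0 := F.wronskian_eq_zero_of_lt hc hi (d := m) (by rw [hcard]; omega)
    (mem_logDerDeg.mpr ⟨hmem.mp hφ, mem_homogDer.mpr hφh⟩)
  have hψ0 := F.wronskian_eq_zero_of_lt hc hi (d := n) (by rw [hcard]; omega)
    (mem_logDerDeg.mpr ⟨hmem.mp hψ, mem_homogDer.mpr hψh⟩)
  obtain ⟨θ, hθ, hne⟩ := F.exists_wronskian_ne_zero hc hi
  obtain ⟨c, hc', -⟩ := h θ (hmem.mpr hθ)
  have e : θ = c.1 • X + c.2.1 • φ + c.2.2 • ψ := hc'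
  apply hne
  rw [e, map_add, map_add, F.wronskian_smul, F.wronskian_smul, F.wronskian_smul, F.wronskian_X,
    hφ0, hψ0, mul_zero, mul_zero, mul_zero, add_zero, add_zero]

end ExponentBound

section Main

lemma b2_le_add_sum {A B : Finset (Set (K × K))} (hA : IsLineArr A) (hBA : B ⊆ A) {k : ℕ}
    (hk : ∀ H ∈ A, nOn A H ≤ k) : b2 A ≤ b2 B + (A.card - B.card) * k := by
  classical
  have key : ∀ C : Finset (Set (K × K)), C ⊆ A → Disjoint B C →
      b2 (B ∪ C) ≤ b2 B + C.card * k := by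
    intro C
    induction C using Finset.induction_on with
    | empty => simp
    | insert H C hHC ih =>
      intro hCA hdisj
      obtain ⟨hHA, hCA⟩ := Finset.insert_subset_iff.mp hCA
      obtain ⟨hHB, hdisj⟩ := Finset.disjoint_insert_right.mp hdisj
      have hsub : B ∪ C ⊆ A := Finset.union_subset hBA hCA
      have h1 : nOn (B ∪ C) H ≤ k := (nOn_mono hA (hA H hHA) hsub).trans (hk H hHA)
      rw [Finset.union_insert, b2_insert (fun L hL => hA L (hsub hL)) (hA H hHA)
        (by simp [hHB, hHC]), Finset.card_insert_of_notMem hHC]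
      have h2 := ih hCA hdisj
      push_cast
      have h3 : (nOn (B ∪ C) H : ℤ) ≤ k := by exact_mod_cast h1
      linear_combination h2 + h3
  have h := key (A \ B) Finset.sdiff_subset Finset.disjoint_sdiff
  rw [Finset.union_sdiff_of_subset hBA] at h
  have hc := Finset.card_sdiff_add_card_eq_card hBA
  have hc' : ((A \ B).card : ℤ) = A.card - B.card := by omega
  rwa [hc'] at h

lemma card_and_b2_of_chi {K : Type*} {A : Finset (Set (K × K))} {n r : ℕ}
    (hchi : ∀ t : ℂ, chi A t = (t - (n : ℂ)) * (t - (n : ℂ) - (r : ℂ))) :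
    A.card = n + (n + r) ∧ b2 A = n * (n + r) := by
  have h0 := hchi 0
  have h1 := hchi 1
  simp only [chi] at h0 h1
  constructor
  · have : (A.card : ℂ) = ((n + (n + r) : ℕ) : ℂ) := by
      push_cast
      linear_combination h0 - h1
    exact_mod_cast this
  · have : (b2 A : ℂ) = ((n * (n + r) : ℤ) : ℂ) := by
      push_cast
      linear_combination h0
    exact_mod_cast this

end Main

/-- **Proposition 5.3 (2)**. Let `χ(A,t) = (t−n)(t−n−r)` with `r ≥ 4`, and assume `A`
contains a free subarrangement `B` with `exp₀(B) = (n−3, n−3)`. Then `A` is free iff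
`n_H = n` or `n_H = n + r` for some `H ∈ A`. -/
theorem free_iff_exists_line_exp_n3_n3
    {K : Type*} [Field K] (A : Finset (Set (K × K))) (hA : IsLineArr A)
    (n r : ℕ) (hr : 4 ≤ r)
    (hchi : ∀ t : ℂ, chi A t = (t - (n : ℂ)) * (t - (n : ℂ) - (r : ℂ)))
    (B : Finset (Set (K × K))) (hBA : B ⊆ A)
    (hBfree : IsFreeExpZ B ((n : ℤ) - 3) ((n : ℤ) - 3)) :
    IsFree A ↔ ∃ H ∈ A, nOn A H = n ∨ nOn A H = n + r := by
  obtain ⟨hcard, hb2⟩ := card_and_b2_of_chi hchi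
  have hcardz : (A.card : ℤ) = n + (n + r) := by exact_mod_cast hcard
  constructor
  · rintro ⟨d₁, d₂, hfree⟩
    obtain ⟨e₁, e₂, he₁, he₂, hB⟩ := hBfree
    obtain ⟨hsumB, hprodB⟩ := hB.exponents fun L hL => hA L (hBA hL)
    obtain ⟨hsum, hprod⟩ := hfree.exponents hA
    have hmax : max d₁ d₂ ≤ n + r := by
      have hsumz : (d₁ : ℤ) + d₂ = n + (n + r) := by rw [← hcardz, ← hsum, Nat.cast_add]
      have h : ((d₁ : ℤ) - n) * (d₁ - (n + r)) = 0 := by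
        rw [hb2] at hprod
        linear_combination d₁ * hsumz - hprod
      rcases mul_eq_zero.mp h with h | h <;> omega
    by_contra! hne
    have hlt : ∀ H ∈ A, nOn A H ≤ n - 1 := by
      intro H hH
      obtain ⟨-, hle, -⟩ := nOn_mul_le_b2 hA hH
      have hup := (hfree.nOn_le_max hA hH).trans hmax
      obtain ⟨h1, h2⟩ := hne H hH
      by_contra! hlow
      have h3 : (n : ℤ) + 1 ≤ nOn A H := by omega
      have h4 : (nOn A H : ℤ) + 1 ≤ n + r := by omega
      rw [hb2, hcardz] at hle
      nlinarith
    have hbound := b2_le_add_sum hA hBA hlt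
    have hn : ((n - 1 : ℕ) : ℤ) = n - 1 := by omega
    have hcardB : (B.card : ℤ) = 2 * n - 6 := by omega
    rw [hb2, ← hprodB, he₁, he₂, hn, hcardz, hcardB] at hbound
    have hr' : (4 : ℤ) ≤ r := by exact_mod_cast hr
    linarith
  · rintro ⟨H, hH, h⟩
    refine ⟨_, _, (nOn_mul_le_b2 hA hH).2.2 ?_⟩
    rw [hb2, hcardz]
    rcases h with h | h
    · rw [h]
      ring
    · rw [h]
      push_cast
      ring
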